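/- arXiv:2102.09911 — 4 statements merged into one kernel-verified Lean document; each statement's English description precedes it below -/
import Mathlib

section
/- Let n ≥ 2 and define j̄*(τ) := sup{ ξ:τ − j̄(ξ) : ξ real symmetric n×n }. Then for every real symmetric n×n matrix τ with det τ = 0 one has j̄*(τ) = ½|τ|². -/
open Matrix Polynomial
open scoped BigOperators

/-- Squared Frobenius norm of a matrix. -/
noncomputable def frobSq {n : ℕ} (ξ : Matrix (Fin n) (Fin n) ℝ) : ℝ :=
  ∑ i, ∑ j, (ξ i j) ^ 2

/-- Frobenius inner product ξ:τ = tr(ξτ) of symmetric matrices. -/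
noncomputable def frobInner {n : ℕ} (ξ τ : Matrix (Fin n) (Fin n) ℝ) : ℝ :=
  Matrix.trace (ξ * τ)

/-- j̄(ξ) = sup over singular symmetric τ of (ξ:τ − ½|τ|²). -/
noncomputable def jbar {n : ℕ} (ξ : Matrix (Fin n) (Fin n) ℝ) : ℝ :=
  sSup {v : ℝ | ∃ τ : Matrix (Fin n) (Fin n) ℝ,
    τ.IsSymm ∧ τ.det = 0 ∧ v = frobInner ξ τ - frobSq τ / 2}

/-- The convex conjugate j̄*(τ) = sup over symmetric ξ of (ξ:τ − j̄(ξ)). -/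
noncomputable def jbarStar {n : ℕ} (τ : Matrix (Fin n) (Fin n) ℝ) : ℝ :=
  sSup {v : ℝ | ∃ ξ : Matrix (Fin n) (Fin n) ℝ,
    ξ.IsSymm ∧ v = frobInner ξ τ - jbar ξ}

theorem frobInner_eq_sum {n : ℕ} (ξ : Matrix (Fin n) (Fin n) ℝ)
    {σ : Matrix (Fin n) (Fin n) ℝ} (hσ : σ.IsSymm) :
    frobInner ξ σ = ∑ i, ∑ j, ξ i j * σ i j := by
  simp only [frobInner, Matrix.trace, Matrix.diag_apply, Matrix.mul_apply]
  exact Finset.sum_congr rfl fun i _ => Finset.sum_congr rfl fun j _ => by rw [hσ.apply]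

theorem frobInner_self {n : ℕ} {τ : Matrix (Fin n) (Fin n) ℝ} (hτ : τ.IsSymm) :
    frobInner τ τ = frobSq τ := by
  simp only [frobInner_eq_sum τ hτ, frobSq, sq]

theorem frobInner_le {n : ℕ} (ξ : Matrix (Fin n) (Fin n) ℝ)
    {σ : Matrix (Fin n) (Fin n) ℝ} (hσ : σ.IsSymm) :
    frobInner ξ σ ≤ frobSq ξ / 2 + frobSq σ / 2 := by
  rw [frobInner_eq_sum ξ hσ, frobSq, frobSq, ← add_div, le_div_iff₀ two_pos]
  simp only [Finset.sum_mul, ← Finset.sum_add_distrib]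
  refine Finset.sum_le_sum fun i _ => Finset.sum_le_sum fun j _ => ?_
  nlinarith [sq_nonneg (ξ i j - σ i j)]

/-- The conjugate `jbar` is at least each of its affine minorants. -/
theorem le_jbar {n : ℕ} (ξ : Matrix (Fin n) (Fin n) ℝ) {τ : Matrix (Fin n) (Fin n) ℝ}
    (hτ : τ.IsSymm) (hdet : τ.det = 0) : frobInner ξ τ - frobSq τ / 2 ≤ jbar ξ := by
  refine le_csSup ⟨frobSq ξ / 2, ?_⟩ ⟨τ, hτ, hdet, rfl⟩
  rintro _ ⟨σ, hσ, -, rfl⟩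
  linarith [frobInner_le ξ hσ]

theorem jbar_eq_on_singular {n : ℕ} {τ : Matrix (Fin n) (Fin n) ℝ}
    (hτ : τ.IsSymm) (hdet : τ.det = 0) : jbar τ = frobSq τ / 2 := by
  apply le_antisymm
  · refine csSup_le ⟨_, τ, hτ, hdet, rfl⟩ ?_
    rintro _ ⟨σ, hσ, -, rfl⟩
    linarith [frobInner_le τ hσ]
  · linarith [le_jbar τ hτ hdet, frobInner_self hτ]

theorem jbarStar_eq_on_singular (n : ℕ) (hn : 2 ≤ n)
    (τ : Matrix (Fin n) (Fin n) ℝ) (hτ : τ.IsSymm) (hdet : τ.det = 0) :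
    jbarStar τ = frobSq τ / 2 := by
  refine IsGreatest.csSup_eq ⟨⟨τ, hτ, ?_⟩, ?_⟩
  · linarith [jbar_eq_on_singular hτ hdet, frobInner_self hτ]
  · rintro _ ⟨ξ, -, rfl⟩
    linarith [le_jbar ξ hτ hdet]
end

section
/- For every real symmetric 3×3 matrix τ with eigenvalues τ₁, τ₂, τ₃ ordered by increasing absolute value, one has ρ°(τ) := sup{ ξ:τ : ξ real symmetric 3×3 with ξ₂² + ξ₃² ≤ 1 } = √((|τ₁| + |τ₂|)² + τ₃²) if |τ₁| + |τ₂| ≤ |τ₃|, and ρ°(τ) = (1/√2)(|τ₁| + |τ₂| + |τ₃|) if |τ₁| + |τ₂| > |τ₃|, where ξ₂, ξ₃ are the two largest-in-modulus eigenvalues of ξ. -/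
open Matrix Polynomial
open scoped BigOperators

/-- ρ°(τ) := sup { ξ:τ : ξ real symmetric 3×3 whose eigenvalues ξ₁, ξ₂, ξ₃,
ordered by increasing modulus, satisfy ξ₂² + ξ₃² ≤ 1 }. -/
noncomputable def rhoPolar3 (τ : Matrix (Fin 3) (Fin 3) ℝ) : ℝ :=
  sSup {v : ℝ | ∃ (ξ : Matrix (Fin 3) (Fin 3) ℝ) (f : Fin 3 → ℝ),
    ξ.IsSymm ∧ ξ.charpoly = ∏ i : Fin 3, (Polynomial.X - Polynomial.C (f i)) ∧
    (∀ i j : Fin 3, i ≤ j → |f i| ≤ |f j|) ∧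
    f 1 ^ 2 + f 2 ^ 2 ≤ 1 ∧
    v = frobInner ξ τ}

/-- A real symmetric matrix is orthogonally conjugate to the diagonal matrix of the roots of its
characteristic polynomial, taken in any order. -/
theorem Matrix.IsSymm.exists_unitary_conj_diagonal {n : Type*} [Fintype n] [DecidableEq n]
    {A : Matrix n n ℝ} (hA : A.IsSymm) {f : n → ℝ}
    (hf : A.charpoly = ∏ i, (X - C (f i))) :
    ∃ U ∈ unitaryGroup n ℝ, A = U * diagonal f * star U := by
  have hA' : A.IsHermitian := by
    rwa [IsHermitian, conjTranspose_eq_transpose_of_trivial]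
  have hD : (diagonal f).IsHermitian := by simp [IsHermitian]
  have heq : hA'.eigenvalues = hD.eigenvalues :=
    (IsHermitian.eigenvalues_eq_eigenvalues_iff hA' hD).2 (by rw [hf, charpoly_diagonal])
  have h₁ := hA'.spectral_theorem
  have h₂ := hD.spectral_theorem
  rw [Unitary.conjStarAlgAut_apply] at h₁ h₂
  rw [heq] at h₁
  set U := hA'.eigenvectorUnitary
  set V := hD.eigenvectorUnitary
  have hV : star (V : Matrix n n ℝ) * V = 1 := Unitary.coe_star_mul_self V
  refine ⟨U * star V, (U * star V).2, ?_⟩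
  set D := diagonal (RCLike.ofReal ∘ hD.eigenvalues : n → ℝ)
  calc A = U * (star (V : Matrix n n ℝ) * V) * D * (star (V : Matrix n n ℝ) * V) *
        star (U : Matrix n n ℝ) := by rw [hV]; simpa using h₁
    _ = _ := by
      rw [h₂]
      simp only [star_mul, Unitary.coe_star, star_star, mul_assoc]

/-- Conjugating a diagonal matrix by a unitary matrix does not change the characteristic
polynomial. -/
theorem Matrix.charpoly_unitary_conj_diagonal {n : Type*} [Fintype n] [DecidableEq n]
    {U : Matrix n n ℝ} (hU : U ∈ unitaryGroup n ℝ) (c : n → ℝ) :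
    (U * diagonal c * star U).charpoly = ∏ i, (X - C (c i)) := by
  rw [charpoly_mul_comm, ← mul_assoc, (Unitary.mem_iff.1 hU).1, one_mul, charpoly_diagonal]

theorem frobInner_unitary_conj_diagonal {n : ℕ} {U V : Matrix (Fin n) (Fin n) ℝ}
    (f e : Fin n → ℝ) :
    frobInner (U * diagonal f * star U) (V * diagonal e * star V) =
      ∑ i, ∑ j, (star U * V) i j ^ 2 * (f i * e j) := by
  have h : star V * U = (star U * V)ᵀ := by simp [star_eq_conjTranspose, transpose_mul]
  calc _ = trace (diagonal f * ((star U * V) * diagonal e * (star V * U))) := by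
        rw [frobInner, mul_assoc, mul_assoc, trace_mul_comm]
        simp only [mul_assoc]
    _ = _ := by
        rw [h]
        simp only [trace, diag_apply, diagonal_mul, mul_apply (M := _ * diagonal e), mul_diagonal,
          transpose_apply, Finset.mul_sum]
        exact Finset.sum_congr rfl fun i _ => Finset.sum_congr rfl fun j _ => by ring

theorem Matrix.sum_row_sq_of_mem_unitaryGroup {n : Type*} [Fintype n] [DecidableEq n]
    {U : Matrix n n ℝ} (hU : U ∈ unitaryGroup n ℝ) (i : n) : ∑ j, U i j ^ 2 = 1 := by
  have h := congrFun (congrFun (Unitary.mem_iff.1 hU).2 i) i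
  simpa [mul_apply, star_apply, ← pow_two] using h

theorem Matrix.sum_col_sq_of_mem_unitaryGroup {n : Type*} [Fintype n] [DecidableEq n]
    {U : Matrix n n ℝ} (hU : U ∈ unitaryGroup n ℝ) (j : n) : ∑ i, U i j ^ 2 = 1 := by
  simpa [star_apply] using sum_row_sq_of_mem_unitaryGroup (Unitary.star_mem hU) j

/-- The trace inequality that bounds `ξ : τ` by the two largest moduli of eigenvalues of `ξ`. -/
theorem frobInner_le_of_eigenvalues {ξ τ : Matrix (Fin 3) (Fin 3) ℝ} (hξ : ξ.IsSymm)
    (hτ : τ.IsSymm) {f e : Fin 3 → ℝ} (hf : ξ.charpoly = ∏ i, (X - C (f i)))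
    (he : τ.charpoly = ∏ i, (X - C (e i))) (hfo : ∀ i j, i ≤ j → |f i| ≤ |f j|)
    (heo : ∀ i j, i ≤ j → |e i| ≤ |e j|) :
    frobInner ξ τ ≤ |f 1| * (|e 0| + |e 1|) + |f 2| * |e 2| := by
  obtain ⟨U, hU, rfl⟩ := hξ.exists_unitary_conj_diagonal hf
  obtain ⟨V, hV, rfl⟩ := hτ.exists_unitary_conj_diagonal he
  rw [frobInner_unitary_conj_diagonal]
  have hW : star U * V ∈ unitaryGroup (Fin 3) ℝ := mul_mem (Unitary.star_mem hU) hV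
  set S : Fin 3 → Fin 3 → ℝ := fun i j => (star U * V) i j ^ 2
  have hS : ∀ i j, 0 ≤ S i j := fun i j => sq_nonneg _
  have hrow : ∑ j, S 2 j = 1 := sum_row_sq_of_mem_unitaryGroup hW 2
  have hcol : ∀ j, ∑ i, S i j = 1 := sum_col_sq_of_mem_unitaryGroup hW
  have hf01 := hfo 0 1 (by decide)
  have hf12 := hfo 1 2 (by decide)
  calc ∑ i, ∑ j, S i j * (f i * e j)
      ≤ ∑ i, ∑ j, S i j * (![|f 1|, |f 1|, |f 2|] i * |e j|) := by
        refine Finset.sum_le_sum fun i _ => Finset.sum_le_sum fun j _ => ?_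
        refine mul_le_mul_of_nonneg_left ?_ (hS i j)
        refine (le_abs_self _).trans ?_
        rw [abs_mul]
        refine mul_le_mul_of_nonneg_right ?_ (abs_nonneg _)
        fin_cases i <;> simp [hf01]
    _ = |f 1| * ∑ j, (∑ i, S i j) * |e j| + (|f 2| - |f 1|) * ∑ j, S 2 j * |e j| := by
        simp [Fin.sum_univ_three]
        ring
    _ ≤ |f 1| * ∑ j, |e j| + (|f 2| - |f 1|) * ∑ j, S 2 j * |e 2| := by
        simp only [hcol, one_mul]
        refine add_le_add le_rfl (mul_le_mul_of_nonneg_left ?_ (sub_nonneg.2 hf12))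
        exact Finset.sum_le_sum fun j _ =>
          mul_le_mul_of_nonneg_left (heo j 2 (Fin.le_last j)) (hS 2 j)
    _ = |f 1| * (|e 0| + |e 1|) + |f 2| * |e 2| := by
        rw [← Finset.sum_mul, hrow, Fin.sum_univ_three]
        ring

/-- A value of the linear form `a * (|e 0| + |e 1|) + b * |e 2|` that is attained on the
constraint set and bounds it from above is the polar `ρ°(τ)`. -/
theorem rhoPolar3_eq {τ : Matrix (Fin 3) (Fin 3) ℝ} (hτ : τ.IsSymm) {e : Fin 3 → ℝ}
    (he : τ.charpoly = ∏ i, (X - C (e i))) (heo : ∀ i j, i ≤ j → |e i| ≤ |e j|) {a b : ℝ}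
    (ha : 0 ≤ a) (hab : a ≤ b) (hab1 : a ^ 2 + b ^ 2 ≤ 1)
    (hmax : ∀ x y : ℝ, 0 ≤ x → x ≤ y → x ^ 2 + y ^ 2 ≤ 1 →
      x * (|e 0| + |e 1|) + y * |e 2| ≤ a * (|e 0| + |e 1|) + b * |e 2|) :
    rhoPolar3 τ = a * (|e 0| + |e 1|) + b * |e 2| := by
  refine IsGreatest.csSup_eq ⟨?_, ?_⟩
  · obtain ⟨U, hU, hUe⟩ := hτ.exists_unitary_conj_diagonal he
    have hsign : ∀ i, ∃ s : ℝ, |s| = 1 ∧ s * e i = |e i| := fun i => by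
      rcases le_total 0 (e i) with h | h
      · exact ⟨1, by simp, by simp [abs_of_nonneg h]⟩
      · exact ⟨-1, by simp, by simp [abs_of_nonpos h]⟩
    choose s hs1 hse using hsign
    set c : Fin 3 → ℝ := fun i => s i * ![a, a, b] i with hc
    have habs : ∀ i, |c i| = ![a, a, b] i := fun i => by
      rw [hc, abs_mul, hs1, one_mul, abs_of_nonneg]
      fin_cases i <;> simp [ha, ha.trans hab]
    refine ⟨U * diagonal c * star U, c, ?_, charpoly_unitary_conj_diagonal hU c, ?_, ?_, ?_⟩
    · simp [IsSymm, star_eq_conjTranspose, transpose_mul, mul_assoc]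
    · intro i j hij
      rw [habs, habs]
      fin_cases i <;> fin_cases j <;> simp_all
    · rw [← sq_abs (c 1), ← sq_abs (c 2), habs, habs]
      simpa using hab1
    · rw [hUe, frobInner_unitary_conj_diagonal, (Unitary.mem_iff.1 hU).1]
      simp [Fin.sum_univ_three, hc, ← hse]
      ring
  · rintro v ⟨ξ, f, hξ, hf, hfo, hf1, rfl⟩
    exact (frobInner_le_of_eigenvalues hξ hτ hf he hfo heo).trans
      (hmax _ _ (abs_nonneg _) (hfo 1 2 (by decide)) (by simpa using hf1))

theorem polar_dim3 (τ : Matrix (Fin 3) (Fin 3) ℝ) (hτ : τ.IsSymm)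
    (e : Fin 3 → ℝ)
    (heig : τ.charpoly = ∏ i : Fin 3, (Polynomial.X - Polynomial.C (e i)))
    (hord : ∀ i j : Fin 3, i ≤ j → |e i| ≤ |e j|) :
    (|e 0| + |e 1| ≤ |e 2| →
      rhoPolar3 τ = Real.sqrt ((|e 0| + |e 1|) ^ 2 + e 2 ^ 2)) ∧
    (|e 2| < |e 0| + |e 1| →
      rhoPolar3 τ = (1 / Real.sqrt 2) * (|e 0| + |e 1| + |e 2|)) := by
  constructor
  · intro h
    set p := |e 0| + |e 1| with hp
    have hp0 : 0 ≤ p := by positivity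
    rw [← sq_abs (e 2)]
    set q := |e 2|
    set N := √(p ^ 2 + q ^ 2) with hN
    have hN0 : 0 ≤ N := Real.sqrt_nonneg _
    have hNsq : N ^ 2 = p ^ 2 + q ^ 2 := Real.sq_sqrt (by positivity)
    have hval : p / N * p + q / N * q = N := by
      rw [div_mul_eq_mul_div, div_mul_eq_mul_div, ← add_div, ← pow_two, ← pow_two, ← hNsq, pow_two,
        mul_self_div_self]
    rw [rhoPolar3_eq hτ heig hord (a := p / N) (b := q / N) (by positivity) (by gcongr) ?_ ?_, hval]
    · rw [div_pow, div_pow, ← add_div, ← hNsq]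
      exact div_self_le_one _
    · intro x y _ _ hxy
      rw [← hp, hval]
      refine Real.le_sqrt_of_sq_le ?_
      nlinarith [sq_nonneg (x * q - y * p),
        mul_nonneg (sub_nonneg.2 hxy) (add_nonneg (sq_nonneg p) (sq_nonneg q))]
  · intro h
    have hr : (1 / √2) ^ 2 = (1 / 2 : ℝ) := by norm_num [div_pow]
    have hr0 : 0 ≤ 1 / √2 := by positivity
    set r := 1 / √2
    rw [rhoPolar3_eq hτ heig hord (a := r) (b := r) hr0 le_rfl (by linarith) ?_]
    · ring
    · intro x y hx hxy hxy1
      have hsum : x + y ≤ 2 * r := abs_le_of_sq_le_sq' (by nlinarith [sq_nonneg (x - y)])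
        (by positivity) |>.2
      have hxr : x ≤ r := abs_le_of_sq_le_sq' (by nlinarith) hr0 |>.2
      nlinarith [mul_nonneg (sub_nonneg.2 h.le) (sub_nonneg.2 hxr),
        mul_nonneg (abs_nonneg (e 2)) (sub_nonneg.2 hsum)]
end

section
/- Let q be a real quadratic form on the space of real symmetric 3×3 matrices. If q(τ) = 0 for every real symmetric 3×3 matrix τ with det τ = 0, then q is identically zero. Equivalently, there are no nonzero Λ_div-affine quadratic forms on symmetric 3×3 matrices. -/
open Matrix
open scoped BigOperators

/-- A sum of two rank-one matrices of size 3 is singular. -/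
lemma det_vecMulVec_add_vecMulVec_fin_three (v w : Fin 3 → ℝ) :
    (vecMulVec v v + vecMulVec w w).det = 0 := by
  simp only [det_fin_three, Matrix.add_apply, vecMulVec_apply]
  ring

lemma isSymm_vecMulVec_self (v : Fin 3 → ℝ) : (vecMulVec v v).IsSymm := by
  ext i j
  simp [vecMulVec_apply, mul_comm]

/-- Symmetric 3×3 matrices are spanned by the rank-one matrices `v vᵀ`. -/
lemma Matrix.IsSymm.mem_span_vecMulVec_self {τ : Matrix (Fin 3) (Fin 3) ℝ} (hτ : τ.IsSymm) :
    τ ∈ Submodule.span ℝ (Set.range fun v : Fin 3 → ℝ => vecMulVec v v) := by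
  have key : τ = (τ 0 0 - τ 0 1 - τ 0 2) • vecMulVec ![1, 0, 0] ![1, 0, 0]
      + (τ 1 1 - τ 0 1 - τ 1 2) • vecMulVec ![0, 1, 0] ![0, 1, 0]
      + (τ 2 2 - τ 0 2 - τ 1 2) • vecMulVec ![0, 0, 1] ![0, 0, 1]
      + τ 0 1 • vecMulVec ![1, 1, 0] ![1, 1, 0]
      + τ 0 2 • vecMulVec ![1, 0, 1] ![1, 0, 1]
      + τ 1 2 • vecMulVec ![0, 1, 1] ![0, 1, 1] := by
    have h10 := hτ.apply 0 1
    have h20 := hτ.apply 0 2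
    have h21 := hτ.apply 1 2
    ext i j
    fin_cases i <;> fin_cases j <;> simp [h10, h20, h21] <;> ring
  have mem (c : ℝ) (v : Fin 3 → ℝ) : c • vecMulVec v v ∈
      Submodule.span ℝ (Set.range fun v : Fin 3 → ℝ => vecMulVec v v) :=
    Submodule.smul_mem _ _ (Submodule.subset_span ⟨v, rfl⟩)
  rw [key]
  exact add_mem (add_mem (add_mem (add_mem (add_mem (mem _ _) (mem _ _)) (mem _ _))
    (mem _ _)) (mem _ _)) (mem _ _)

/-- There are no nonzero Λ_div-affine quadratic forms on symmetric 3×3 matrices: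
if a quadratic form `q(τ) = B(τ,τ)` (given by a symmetric bilinear form `B`)
vanishes on every singular symmetric 3×3 matrix, then it vanishes on all
symmetric 3×3 matrices. -/
theorem no_lambda_div_affine_quadratic_forms_dim3
    (B : Matrix (Fin 3) (Fin 3) ℝ →ₗ[ℝ] Matrix (Fin 3) (Fin 3) ℝ →ₗ[ℝ] ℝ)
    (hBsymm : ∀ x y : Matrix (Fin 3) (Fin 3) ℝ, B x y = B y x)
    (hvanish : ∀ τ : Matrix (Fin 3) (Fin 3) ℝ, τ.IsSymm → τ.det = 0 → B τ τ = 0) :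
    ∀ τ : Matrix (Fin 3) (Fin 3) ℝ, τ.IsSymm → B τ τ = 0 := by
  have hdiag (v : Fin 3 → ℝ) : B (vecMulVec v v) (vecMulVec v v) = 0 :=
    hvanish _ (isSymm_vecMulVec_self v)
      (by simpa using det_vecMulVec_add_vecMulVec_fin_three v 0)
  have hpair (v w : Fin 3 → ℝ) : B (vecMulVec v v) (vecMulVec w w) = 0 := by
    have h := hvanish _ ((isSymm_vecMulVec_self v).add (isSymm_vecMulVec_self w))
      (det_vecMulVec_add_vecMulVec_fin_three v w)
    simp only [map_add, LinearMap.add_apply, hdiag, hBsymm (vecMulVec w w)] at h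
    linarith
  intro τ hτ
  have hleft (v : Fin 3 → ℝ) : B (vecMulVec v v) τ = 0 := by
    refine (Submodule.span_le (p := LinearMap.ker (B (vecMulVec v v)))).2 ?_
      hτ.mem_span_vecMulVec_self
    rintro _ ⟨w, rfl⟩
    exact hpair v w
  refine (Submodule.span_le (p := LinearMap.ker (B.flip τ))).2 ?_ hτ.mem_span_vecMulVec_self
  rintro _ ⟨v, rfl⟩
  exact hleft v
end

section
/- Let n ≥ 2, let α, β > 0, and let h(τ) := α|τ|² + β for τ ≠ 0 and h(0) := 0, defined on real symmetric n×n matrices. Define Q_div h(τ) := inf{ ∫_{(0,1)ⁿ} h(φ(x)) dx : φ smooth, ℤⁿ-periodic, Sym_n(ℝ)-valued on ℝⁿ, with row-wise divergence div φ = 0 on ℝⁿ and ∫_{(0,1)ⁿ} φ dx = τ }. Then Q_div h is (symmetric) div-quasiconvex: for every smooth ℤⁿ-periodic Sym_n(ℝ)-valued ψ with div ψ = 0 on ℝⁿ, it holds that Q_div h(∫_{(0,1)ⁿ} ψ dx) ≤ ∫_{(0,1)ⁿ} Q_div h(ψ(x)) dx. -/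
open Matrix MeasureTheory
open scoped BigOperators

/-- The open unit cube (0,1)ⁿ in ℝⁿ. -/
def unitCube (n : ℕ) : Set (Fin n → ℝ) :=
  Set.univ.pi fun _ : Fin n => Set.Ioo (0 : ℝ) 1

/-- ℤⁿ-periodicity of a matrix field. -/
def IsZnPeriodic {n : ℕ} (φ : (Fin n → ℝ) → Matrix (Fin n) (Fin n) ℝ) : Prop :=
  ∀ (x : Fin n → ℝ) (k : Fin n → ℤ), φ (x + fun i => (k i : ℝ)) = φ x

/-- Row-wise divergence-freeness: for each row `i`, ∑ⱼ ∂ⱼ φᵢⱼ = 0 everywhere. -/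
def IsDivFree {n : ℕ} (φ : (Fin n → ℝ) → Matrix (Fin n) (Fin n) ℝ) : Prop :=
  ∀ (x : Fin n → ℝ) (i : Fin n),
    ∑ j, fderiv ℝ (fun y => φ y i j) x (Pi.single j 1) = 0

/-- A test field is admissible if it is smooth (entrywise), ℤⁿ-periodic,
symmetric-matrix-valued and divergence-free. -/
def Admissible {n : ℕ} (φ : (Fin n → ℝ) → Matrix (Fin n) (Fin n) ℝ) : Prop :=
  (∀ i j, ContDiff ℝ (⊤ : ℕ∞) fun x => φ x i j) ∧ IsZnPeriodic φ ∧
    (∀ x, (φ x).IsSymm) ∧ IsDivFree φ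

/-- The Kohn–Strang function h(τ) = α|τ|² + β for τ ≠ 0, h(0) = 0. -/
noncomputable def kohnStrang {n : ℕ} (α β : ℝ)
    (τ : Matrix (Fin n) (Fin n) ℝ) : ℝ := by
  classical exact if τ = 0 then 0 else α * frobSq τ + β

/-- The (symmetric) div-quasiconvex envelope of the Kohn–Strang function:
infimum of the average of `h ∘ φ` over all admissible fields `φ` with mean `τ`. -/
noncomputable def QdivKohnStrang (n : ℕ) (α β : ℝ)
    (τ : Matrix (Fin n) (Fin n) ℝ) : ℝ :=
  sInf {v : ℝ | ∃ φ : (Fin n → ℝ) → Matrix (Fin n) (Fin n) ℝ,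
    Admissible φ ∧ (∀ i j, (∫ x in unitCube n, φ x i j) = τ i j) ∧
    v = ∫ x in unitCube n, kohnStrang α β (φ x)}

/-- The partial derivative in the coordinate direction `k`. -/
noncomputable def pd {n : ℕ} (k : Fin n) (f : (Fin n → ℝ) → ℝ) (x : Fin n → ℝ) : ℝ :=
  fderiv ℝ f x (Pi.single k 1)

/-- Smooth `ℤⁿ`-periodic scalar functions. -/
structure SmoothPer {n : ℕ} (f : (Fin n → ℝ) → ℝ) : Prop where
  smooth : ContDiff ℝ (⊤ : ℕ∞) f
  per : ∀ (x : Fin n → ℝ) (k : Fin n → ℤ), f (x + fun i => (k i : ℝ)) = f x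

section pd

variable {n : ℕ} {f g : (Fin n → ℝ) → ℝ}

lemma ContDiff.differentiable_top {E F : Type*} [NormedAddCommGroup E] [NormedSpace ℝ E]
    [NormedAddCommGroup F] [NormedSpace ℝ F] {f : E → F} (hf : ContDiff ℝ (⊤ : ℕ∞) f) :
    Differentiable ℝ f :=
  hf.differentiable (by simp)

lemma ContDiff.pd (hf : ContDiff ℝ (⊤ : ℕ∞) f) (k : Fin n) : ContDiff ℝ (⊤ : ℕ∞) (pd k f) :=
  (contDiff_infty_iff_fderiv.1 hf).2.clm_apply contDiff_const

lemma pd_const (k : Fin n) (c : ℝ) : pd k (fun _ => c) = 0 := by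
  ext x; simp [pd]

lemma pd_zero (k : Fin n) : pd k (0 : (Fin n → ℝ) → ℝ) = 0 := pd_const k 0

lemma pd_add (k : Fin n) (hf : ContDiff ℝ (⊤ : ℕ∞) f) (hg : ContDiff ℝ (⊤ : ℕ∞) g) :
    pd k (f + g) = pd k f + pd k g := by
  ext x
  simp [pd, fderiv_add (hf.differentiable_top x) (hg.differentiable_top x)]

lemma pd_sub (k : Fin n) (hf : ContDiff ℝ (⊤ : ℕ∞) f) (hg : ContDiff ℝ (⊤ : ℕ∞) g) :
    pd k (f - g) = pd k f - pd k g := by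
  ext x
  simp [pd, fderiv_sub (hf.differentiable_top x) (hg.differentiable_top x)]

lemma pd_neg (k : Fin n) : pd k (-f) = -pd k f := by
  ext x
  simp [pd, fderiv_neg]

lemma pd_smul (k : Fin n) (c : ℝ) (hf : ContDiff ℝ (⊤ : ℕ∞) f) :
    pd k (c • f) = c • pd k f := by
  ext x
  simp [pd, fderiv_const_smul (hf.differentiable_top x)]

lemma pd_sum {ι : Type*} (s : Finset ι) (k : Fin n) {F : ι → (Fin n → ℝ) → ℝ}
    (hF : ∀ i, ContDiff ℝ (⊤ : ℕ∞) (F i)) :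
    pd k (∑ i ∈ s, F i) = ∑ i ∈ s, pd k (F i) := by
  ext x
  simp [pd, fderiv_sum fun i _ => (hF i).differentiable_top x]

lemma pd_mul (k : Fin n) (hf : ContDiff ℝ (⊤ : ℕ∞) f) (hg : ContDiff ℝ (⊤ : ℕ∞) g) :
    pd k (f * g) = f * pd k g + pd k f * g := by
  ext x
  simp [pd, fderiv_mul (hf.differentiable_top x) (hg.differentiable_top x), mul_comm]

lemma pd_comm (k l : Fin n) (hf : ContDiff ℝ (⊤ : ℕ∞) f) :
    pd k (pd l f) = pd l (pd k f) := by
  have key : ∀ k l x,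
      pd k (pd l f) x = fderiv ℝ (fderiv ℝ f) x (Pi.single k 1) (Pi.single l 1) := by
    intro k l x
    have h := (contDiff_infty_iff_fderiv.1 hf).2.differentiable_top x
    have := (h.hasFDerivAt.clm_apply (hasFDerivAt_const (Pi.single l (1 : ℝ)) x)).fderiv
    change fderiv ℝ (fun y => fderiv ℝ f y (Pi.single l 1)) x _ = _
    rw [this]; simp
  ext x
  rw [key, key]
  exact (hf.contDiffAt.isSymmSndFDerivAt
    (by simpa using WithTop.coe_le_coe.2 (le_top : (2 : ℕ∞) ≤ ⊤))).eq _ _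

lemma pd_congr_of_eventuallyEq (k : Fin n) {x : Fin n → ℝ} (h : f =ᶠ[nhds x] g) :
    pd k f =ᶠ[nhds x] pd k g :=
  h.eventuallyEq_nhds.mono fun y hy => by simp [pd, hy.fderiv_eq]

lemma pd_comp_add (k : Fin n) (a x : Fin n → ℝ) :
    pd k (fun y => f (y + a)) x = pd k f (x + a) := by
  simp [pd, fderiv_comp_add_right]

lemma pd_comp_affine (k : Fin n) (hf : ContDiff ℝ (⊤ : ℕ∞) f) (p : Fin n → ℝ) (s : ℝ) :
    pd k (fun y => f (p + s • y)) = fun y => s * pd k f (p + s • y) := by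
  ext y
  have h1 : HasFDerivAt (fun y : Fin n → ℝ => p + s • y)
      (s • ContinuousLinearMap.id ℝ (Fin n → ℝ)) y :=
    ((hasFDerivAt_id y).const_smul s).const_add p
  have := (((hf.differentiable_top (p + s • y)).hasFDerivAt).comp y h1).fderiv
  change fderiv ℝ (f ∘ fun y => p + s • y) y _ = _
  rw [this]; simp [pd]

lemma fderiv_apply_eq_sum_pd (x v : Fin n → ℝ) : fderiv ℝ f x v = ∑ k, v k * pd k f x := by
  conv_lhs => rw [pi_eq_sum_univ' v]
  simp [pd, map_sum]

lemma norm_fderiv_le_of_pd {ω : ℝ} {x : Fin n → ℝ} (h : ∀ k, |pd k f x| ≤ ω) :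
    ‖fderiv ℝ f x‖ ≤ n * ω := by
  rcases Nat.eq_zero_or_pos n with rfl | hn
  · simp [Subsingleton.elim (fderiv ℝ f x) 0]
  have hω : 0 ≤ ω := (abs_nonneg _).trans (h ⟨0, hn⟩)
  refine ContinuousLinearMap.opNorm_le_bound _ (by positivity) fun v => ?_
  rw [fderiv_apply_eq_sum_pd, Real.norm_eq_abs]
  calc |∑ k, v k * pd k f x| ≤ ∑ k, |v k * pd k f x| := Finset.abs_sum_le_sum_abs _ _
    _ ≤ ∑ _k : Fin n, ‖v‖ * ω := Finset.sum_le_sum fun k _ => by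
        rw [abs_mul]
        exact mul_le_mul (norm_le_pi_norm v k) (h k) (abs_nonneg _) (norm_nonneg _)
    _ = n * ω * ‖v‖ := by simp; ring

lemma abs_le_of_abs_pd_le_of_zero {ω : ℝ} (hf : ContDiff ℝ (⊤ : ℕ∞) f) (h0 : f 0 = 0)
    (h : ∀ k, ∀ y ∈ Set.Icc (0 : Fin n → ℝ) 1, |pd k f y| ≤ ω) {y : Fin n → ℝ}
    (hy : y ∈ Set.Icc (0 : Fin n → ℝ) 1) : |f y| ≤ n * ω := by
  have h0' : (0 : Fin n → ℝ) ∈ Set.Icc (0 : Fin n → ℝ) 1 := ⟨le_rfl, fun _ => by simp⟩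
  have := (convex_Icc (0 : Fin n → ℝ) 1).norm_image_sub_le_of_norm_fderiv_le
    (fun z _ => hf.differentiable_top z)
    (fun z hz => norm_fderiv_le_of_pd fun k => h k z hz) h0' hy
  rw [h0, sub_zero, sub_zero, Real.norm_eq_abs] at this
  refine this.trans ?_
  rcases Nat.eq_zero_or_pos n with rfl | hn
  · simp
  have hω : 0 ≤ ω := (abs_nonneg _).trans (h ⟨0, hn⟩ 0 h0')
  refine mul_le_of_le_one_right (by positivity) ?_
  refine (pi_norm_le_iff_of_nonneg zero_le_one).2 fun i => ?_
  rw [Real.norm_eq_abs, abs_le]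
  exact ⟨by linarith [show (0:ℝ) ≤ y i from hy.1 i], hy.2 i⟩

end pd

namespace SmoothPer

variable {n : ℕ} {f g : (Fin n → ℝ) → ℝ}

lemma const (c : ℝ) : SmoothPer fun _ : Fin n → ℝ => c := ⟨contDiff_const, fun _ _ => rfl⟩

lemma add (hf : SmoothPer f) (hg : SmoothPer g) : SmoothPer (f + g) :=
  ⟨hf.smooth.add hg.smooth, fun x k => by simp [hf.per, hg.per]⟩

lemma smul (c : ℝ) (hf : SmoothPer f) : SmoothPer (c • f) :=
  ⟨contDiff_const.smul hf.smooth, fun x k => by simp [hf.per]⟩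

lemma pd (hf : SmoothPer f) (k : Fin n) : SmoothPer (pd k f) := by
  refine ⟨hf.smooth.pd k, fun x m => ?_⟩
  rw [← pd_comp_add]
  congr 1
  exact funext fun y => hf.per y m

lemma exists_mem_Icc (x : Fin n → ℝ) : ∃ y ∈ Set.Icc (0 : Fin n → ℝ) 1, ∃ k : Fin n → ℤ,
    x = y + fun i => (k i : ℝ) :=
  ⟨fun i => Int.fract (x i), ⟨fun _ => Int.fract_nonneg _, fun _ => (Int.fract_lt_one _).le⟩,
    fun i => ⌊x i⌋, funext fun i => (Int.fract_add_floor (x i)).symm⟩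

lemma exists_bound (hf : SmoothPer f) : ∃ M, ∀ x, |f x| ≤ M := by
  obtain ⟨M, hM⟩ := (isCompact_Icc (a := (0 : Fin n → ℝ)) (b := 1)).exists_bound_of_continuousOn
    hf.smooth.continuous.continuousOn
  refine ⟨M, fun x => ?_⟩
  obtain ⟨y, hy, k, rfl⟩ := exists_mem_Icc x
  rw [hf.per]; exact hM y hy

end SmoothPer

section averaging

variable {E F : Type} [NormedAddCommGroup E] [NormedSpace ℝ E] [ProperSpace E]
  [NormedAddCommGroup F] [NormedSpace ℝ F]

/-- The weighted average of `f` over the segment from `x` to `x + v`. -/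
noncomputable def segAvg (w : ℝ → ℝ) (v : E) (f : E → F) (x : E) : F :=
  ∫ t in (0 : ℝ)..1, w t • f (x + t • v)

lemma hasFDerivAt_segAvg {w : ℝ → ℝ} (hw : Continuous w) (v : E) {f : E → F}
    (hf : ContDiff ℝ (⊤ : ℕ∞) f) (x : E) :
    HasFDerivAt (segAvg w v f) (segAvg w v (fderiv ℝ f) x) x := by
  have hf' : Continuous (fderiv ℝ f) := (contDiff_infty_iff_fderiv.1 hf).2.continuous
  obtain ⟨M, hM⟩ := (isCompact_closedBall x (1 + ‖v‖)).exists_bound_of_continuousOn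
    (f := fderiv ℝ f) hf'.continuousOn
  obtain ⟨K, hK⟩ := (isCompact_Icc (a := (0 : ℝ)) (b := 1)).exists_bound_of_continuousOn
    hw.continuousOn
  refine intervalIntegral.hasFDerivAt_integral_of_dominated_of_fderiv_le (𝕜 := ℝ)
    (F := fun x t => w t • f (x + t • v)) (F' := fun x t => w t • fderiv ℝ f (x + t • v))
    (s := Metric.ball x 1) (bound := fun _ => K * M)
    (Metric.ball_mem_nhds x one_pos) (Filter.Eventually.of_forall fun y => ?_) ?_ ?_ ?_ ?_ ?_
  · exact (hw.smul (hf.continuous.comp (by fun_prop))).aestronglyMeasurable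
  · exact (hw.smul (hf.continuous.comp (by fun_prop))).intervalIntegrable _ _
  · exact (hw.smul (hf'.comp (by fun_prop))).aestronglyMeasurable
  · refine Filter.Eventually.of_forall fun t ht y hy => ?_
    rw [Set.uIoc_of_le zero_le_one] at ht
    rw [norm_smul]
    have h1 := hK t ⟨ht.1.le, ht.2⟩
    refine mul_le_mul h1 (hM _ ?_) (norm_nonneg _) ((norm_nonneg _).trans h1)
    rw [mem_closedBall_iff_norm]
    have h2 : ‖y - x‖ < 1 := by rwa [← mem_ball_iff_norm]
    calc ‖y + t • v - x‖ = ‖(y - x) + t • v‖ := by congr 1; abel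
      _ ≤ ‖y - x‖ + ‖t • v‖ := norm_add_le _ _
      _ ≤ 1 + ‖v‖ := by
        rw [norm_smul, Real.norm_of_nonneg ht.1.le]
        nlinarith [norm_nonneg v, ht.2]
  · exact intervalIntegrable_const
  · refine Filter.Eventually.of_forall fun t _ y _ => ?_
    have h : HasFDerivAt (fun y : E => y + t • v) (ContinuousLinearMap.id ℝ E) y :=
      (hasFDerivAt_id y).add_const _
    exact (((hf.differentiable_top (y + t • v)).hasFDerivAt).comp y h).const_smul (w t)

lemma contDiff_nat_segAvg {w : ℝ → ℝ} (hw : Continuous w) (v : E) (m : ℕ) :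
    ∀ {F : Type} [NormedAddCommGroup F] [NormedSpace ℝ F] [CompleteSpace F] {f : E → F},
      ContDiff ℝ (⊤ : ℕ∞) f → ContDiff ℝ m (segAvg w v f) := by
  induction m with
  | zero =>
    intro F _ _ _ f hf
    exact contDiff_zero.2 (continuous_iff_continuousAt.2 fun x =>
      (hasFDerivAt_segAvg hw v hf x).continuousAt)
  | succ m ih =>
    intro F _ _ _ f hf
    exact contDiff_succ_iff_hasFDerivAt.2
      ⟨_, ih (contDiff_infty_iff_fderiv.1 hf).2, hasFDerivAt_segAvg hw v hf⟩

lemma ContDiff.segAvg [CompleteSpace F] {w : ℝ → ℝ} (hw : Continuous w) (v : E) {f : E → F}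
    (hf : ContDiff ℝ (⊤ : ℕ∞) f) : ContDiff ℝ (⊤ : ℕ∞) (segAvg w v f) :=
  contDiff_infty.2 fun m => contDiff_nat_segAvg hw v m hf

end averaging

section potential

variable {n : ℕ}

lemma segAvg_add {w : ℝ → ℝ} (hw : Continuous w) (v : Fin n → ℝ) {f g : (Fin n → ℝ) → ℝ}
    (hf : Continuous f) (hg : Continuous g) :
    segAvg w v (f + g) = segAvg w v f + segAvg w v g := by
  ext x
  simp only [segAvg, Pi.add_apply, smul_add]
  exact intervalIntegral.integral_add
    (hw.smul (hf.comp (by fun_prop))).continuousOn.intervalIntegrable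
    (hw.smul (hg.comp (by fun_prop))).continuousOn.intervalIntegrable

lemma segAvg_smul (w : ℝ → ℝ) (v : Fin n → ℝ) (c : ℝ) (f : (Fin n → ℝ) → ℝ) :
    segAvg w v (c • f) = c • segAvg w v f := by
  ext x
  simp only [segAvg, Pi.smul_apply, smul_comm _ c]
  exact intervalIntegral.integral_smul c _

lemma SmoothPer.segAvg {w : ℝ → ℝ} (hw : Continuous w) (v : Fin n → ℝ) {f : (Fin n → ℝ) → ℝ}
    (hf : SmoothPer f) : SmoothPer (segAvg w v f) :=
  ⟨hf.smooth.segAvg hw v, fun x k => by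
    simp only [_root_.segAvg, add_right_comm x _ (_ • v), hf.per]⟩

lemma pd_segAvg {w : ℝ → ℝ} (hw : Continuous w) (v : Fin n → ℝ) {f : (Fin n → ℝ) → ℝ}
    (hf : ContDiff ℝ (⊤ : ℕ∞) f) (k : Fin n) : pd k (segAvg w v f) = segAvg w v (pd k f) := by
  ext x
  rw [pd, (hasFDerivAt_segAvg hw v hf x).fderiv, segAvg, ContinuousLinearMap.intervalIntegral_apply]
  · rfl
  · exact (hw.smul ((contDiff_infty_iff_fderiv.1 hf).2.continuous.comp
      (by fun_prop))).continuousOn.intervalIntegrable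

lemma hasDerivAt_line {f : (Fin n → ℝ) → ℝ} (hf : ContDiff ℝ (⊤ : ℕ∞) f) (k : Fin n)
    (x : Fin n → ℝ) (t : ℝ) :
    HasDerivAt (fun t : ℝ => f (x + t • Pi.single k 1)) (pd k f (x + t • Pi.single k 1)) t := by
  have h : HasDerivAt (fun t : ℝ => x + t • (Pi.single k 1 : Fin n → ℝ)) (Pi.single k 1) t := by
    simpa using ((hasDerivAt_id t).smul_const (Pi.single k 1 : Fin n → ℝ)).const_add x
  exact (hf.differentiable_top _).hasFDerivAt.comp_hasDerivAt t h

lemma SmoothPer.add_single {f : (Fin n → ℝ) → ℝ} (hf : SmoothPer f) (k : Fin n)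
    (x : Fin n → ℝ) : f (x + Pi.single k 1) = f x := by
  rw [← hf.per x (Pi.single k 1)]
  congr 2
  ext i
  by_cases h : i = k
  · subst h; simp
  · simp [h]

lemma segAvg_one_pd {f : (Fin n → ℝ) → ℝ} (hf : SmoothPer f) (k : Fin n) :
    segAvg (fun _ => 1) (Pi.single k 1) (pd k f) = 0 := by
  ext x
  simp only [segAvg, one_smul]
  rw [intervalIntegral.integral_eq_sub_of_hasDerivAt (fun t _ => hasDerivAt_line hf.smooth k x t)
    (((hf.smooth.pd k).continuous.comp (by fun_prop)).intervalIntegrable _ _)]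
  simp [hf.add_single]

lemma segAvg_id_pd {f : (Fin n → ℝ) → ℝ} (hf : SmoothPer f) (k : Fin n) :
    segAvg id (Pi.single k 1) (pd k f) = f - segAvg (fun _ => 1) (Pi.single k 1) f := by
  ext x
  simp only [segAvg, smul_eq_mul, Pi.sub_apply]
  rw [intervalIntegral.integral_mul_deriv_eq_deriv_mul (fun t _ => hasDerivAt_id t)
    (fun t _ => hasDerivAt_line hf.smooth k x t) intervalIntegrable_const
    (((hf.smooth.pd k).continuous.comp (by fun_prop)).intervalIntegrable _ _)]
  simp [hf.add_single]

/-- The space of smooth `ℤⁿ`-periodic functions. -/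
def smoothPerSpace (n : ℕ) : Submodule ℝ ((Fin n → ℝ) → ℝ) where
  carrier := {f | SmoothPer f}
  add_mem' := SmoothPer.add
  zero_mem' := SmoothPer.const 0
  smul_mem' c _ hf := SmoothPer.smul c hf

namespace smoothPerSpace

/-- Partial derivative as an endomorphism of the smooth periodic functions. -/
noncomputable def D (k : Fin n) : Module.End ℝ (smoothPerSpace n) where
  toFun f := ⟨pd k f.1, SmoothPer.pd f.2 k⟩
  map_add' f g := Subtype.ext (pd_add k f.2.smooth g.2.smooth)
  map_smul' c f := Subtype.ext (pd_smul k c f.2.smooth)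

/-- Weighted average along a coordinate period as an endomorphism. -/
noncomputable def avg (w : C(ℝ, ℝ)) (k : Fin n) : Module.End ℝ (smoothPerSpace n) where
  toFun f := ⟨segAvg w (Pi.single k 1) f.1, SmoothPer.segAvg w.continuous _ f.2⟩
  map_add' f g := Subtype.ext
    (segAvg_add w.continuous _ f.2.smooth.continuous g.2.smooth.continuous)
  map_smul' c _ := Subtype.ext (segAvg_smul _ _ c _)

lemma D_mul_avg (w : C(ℝ, ℝ)) (j k : Fin n) : D j * avg w k = avg w k * D j :=
  LinearMap.ext fun f => Subtype.ext (pd_segAvg w.continuous _ f.2.smooth j)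

lemma avg_one_mul_D (k : Fin n) : avg (.const ℝ 1) k * D k = 0 :=
  LinearMap.ext fun f => Subtype.ext (segAvg_one_pd f.2 k)

lemma avg_id_D (k : Fin n) (f : smoothPerSpace n) :
    avg (.id ℝ) k (D k f) = f - avg (.const ℝ 1) k f :=
  Subtype.ext (segAvg_id_pd f.2 k)

/-- Average over the first `r` coordinates. -/
noncomputable def partialAvg (n : ℕ) : ℕ → Module.End ℝ (smoothPerSpace n)
  | 0 => 1
  | r + 1 => if h : r < n then avg (.const ℝ 1) ⟨r, h⟩ * partialAvg n r else partialAvg n r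

/-- Right inverses, jointly, of the divergence on functions of mean zero. -/
noncomputable def antiDiv (k : Fin n) : Module.End ℝ (smoothPerSpace n) :=
  avg (.id ℝ) k * partialAvg n k

lemma D_mul_partialAvg (j : Fin n) (r : ℕ) : D j * partialAvg n r = partialAvg n r * D j := by
  induction r with
  | zero => simp [partialAvg]
  | succ r ih =>
    rw [partialAvg]
    split_ifs with h
    · rw [← mul_assoc, D_mul_avg, mul_assoc, ih, mul_assoc]
    · exact ih

lemma D_mul_antiDiv (j k : Fin n) : D j * antiDiv k = antiDiv k * D j := by
  rw [antiDiv, ← mul_assoc, D_mul_avg, mul_assoc, D_mul_partialAvg, mul_assoc]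

lemma D_mul_partialAvg_eq_zero (j : Fin n) (r : ℕ) (hj : (j : ℕ) < r) :
    D j * partialAvg n r = 0 := by
  induction r with
  | zero => simp at hj
  | succ r ih =>
    rw [partialAvg]
    split_ifs with h
    · rw [← mul_assoc]
      rcases Nat.lt_succ_iff_lt_or_eq.1 hj with hj | hj
      · rw [D_mul_avg, mul_assoc, ih hj, mul_zero]
      · obtain rfl : j = ⟨r, h⟩ := Fin.ext hj
        rw [D_mul_avg, avg_one_mul_D, zero_mul]
    · exact ih (by have := j.2; omega)

lemma sum_D_antiDiv (f : smoothPerSpace n) :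
    ∑ k, D k (antiDiv k f) = f - partialAvg n n f := by
  have h : ∀ k : Fin n, D k (antiDiv k f) = partialAvg n k f - partialAvg n (k + 1) f := fun k => by
    have := LinearMap.congr_fun (D_mul_avg (.id ℝ) k k) (partialAvg n k f)
    simp only [Module.End.mul_apply] at this
    simp [antiDiv, this, avg_id_D, partialAvg]
  simp_rw [h]
  rw [Fin.sum_univ_eq_sum_range (fun k => partialAvg n k f - partialAvg n (k + 1) f) n,
    Finset.sum_range_sub' (fun k => partialAvg n k f), partialAvg]
  rfl

lemma D_comm (k l : Fin n) : D k * D l = D l * D k :=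
  LinearMap.ext fun f => Subtype.ext (pd_comm k l f.2.smooth)

lemma exists_const_partialAvg (f : smoothPerSpace n) :
    ∃ c : ℝ, ((partialAvg n n f : smoothPerSpace n) : (Fin n → ℝ) → ℝ) = fun _ => c := by
  set g := partialAvg n n f with hg
  have h : ∀ x, fderiv ℝ g.1 x = 0 := fun x => by
    ext v
    have : ∀ k, pd k g.1 = 0 := fun k =>
      congrArg Subtype.val (LinearMap.congr_fun (D_mul_partialAvg_eq_zero k n k.2) f)
    simp [fderiv_apply_eq_sum_pd, this]
  exact ⟨g.1 0, funext fun x => is_const_of_fderiv_eq_zero g.2.smooth.differentiable_top h x 0⟩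

end smoothPerSpace

/-- Symmetric second-order stress potentials with smooth periodic components. -/
structure IsPot (B : Fin n → Fin n → Fin n → Fin n → (Fin n → ℝ) → ℝ) : Prop where
  smoothPer : ∀ i k j l, SmoothPer (B i k j l)
  anti : ∀ i k j l, B i k l j = -B i k j l
  symm : ∀ i k j l, B j l i k = B i k j l

/-- The stress field `∑ₖₗ ∂ₖ ∂ₗ Bᵢₖⱼₗ` of a potential. -/
noncomputable def stress (B : Fin n → Fin n → Fin n → Fin n → (Fin n → ℝ) → ℝ)
    (x : Fin n → ℝ) : Matrix (Fin n) (Fin n) ℝ :=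
  Matrix.of fun i j => ∑ k, ∑ l, pd k (pd l (B i k j l)) x

open smoothPerSpace in
lemma exists_isPot {φ : (Fin n → ℝ) → Matrix (Fin n) (Fin n) ℝ} (hφ : Admissible φ) :
    ∃ (A : Matrix (Fin n) (Fin n) ℝ) (B : Fin n → Fin n → Fin n → Fin n → (Fin n → ℝ) → ℝ),
      IsPot B ∧ ∀ x, φ x = A + stress B x := by
  obtain ⟨h1, h2, h3, h4⟩ := hφ
  let s : Fin n → Fin n → smoothPerSpace n := fun i j =>
    ⟨fun x => φ x i j, h1 i j, fun x k => by simp only [h2 x k]⟩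
  have hs : ∀ i j, s i j = s j i := fun i j => Subtype.ext (funext fun x => (h3 x).apply j i)
  have hdiv : ∀ i, ∑ j, D j (s i j) = 0 := fun i => Subtype.ext <| by
    ext x
    simpa [s, D, pd] using h4 x i
  have hdiv' : ∀ j, ∑ i, D i (s i j) = 0 := fun j => by simp_rw [hs _ j]; exact hdiv j
  have hDa : ∀ (j k : Fin n) f, D j (antiDiv k f) = antiDiv k (D j f) := fun j k f =>
    LinearMap.congr_fun (D_mul_antiDiv j k) f
  have hDD : ∀ (j k : Fin n) f, D j (D k f) = D k (D j f) := fun j k f =>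
    LinearMap.congr_fun (D_comm j k) f
  have hDp : ∀ (k : Fin n) f, D k (partialAvg n n f) = 0 := fun k f =>
    LinearMap.congr_fun (D_mul_partialAvg_eq_zero k n k.2) f
  have hpD : ∀ (k : Fin n) f, partialAvg n n (D k f) = 0 := fun k f =>
    (LinearMap.congr_fun (D_mul_partialAvg k n) f).symm.trans (hDp k f)
  have hsum : ∀ f, ∑ k : Fin n, antiDiv k (D k f) = f - partialAvg n n f := fun f => by
    simpa [hDa] using sum_D_antiDiv f
  let b : Fin n → Fin n → Fin n → Fin n → smoothPerSpace n := fun i k j l =>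
    antiDiv k (antiDiv l (s i j)) - antiDiv i (antiDiv l (s k j))
      - antiDiv k (antiDiv j (s i l)) + antiDiv i (antiDiv j (s k l))
  have hb : ∀ i j, ∑ k, ∑ l, D k (D l (b i k j l)) = s i j - partialAvg n n (s i j) := by
    intro i j
    have e1 : ∑ k, ∑ l, D k (D l (antiDiv k (antiDiv l (s i j)))) =
        s i j - partialAvg n n (s i j) := by
      have : ∀ k, ∑ l, D k (D l (antiDiv k (antiDiv l (s i j)))) = antiDiv k (D k (s i j)) := by
        intro k
        simp_rw [hDa, ← map_sum, hDD k _ (s i j), hsum, hpD, sub_zero]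
      simp_rw [this, hsum]
    have e2 : ∑ k, ∑ l, D k (D l (antiDiv i (antiDiv l (s k j)))) = 0 := by
      rw [Finset.sum_comm]
      simp_rw [hDa, hDD _ _ (s _ _), ← map_sum, hdiv', map_zero]
      simp
    have e3 : ∑ k, ∑ l, D k (D l (antiDiv k (antiDiv j (s i l)))) = 0 := by
      simp_rw [hDa, ← map_sum, hdiv, map_zero]
      simp
    have e4 : ∑ k, ∑ l, D k (D l (antiDiv i (antiDiv j (s k l)))) = 0 := by
      simp_rw [hDa, ← map_sum, hdiv, map_zero]
      simp
    simp only [b, map_add, map_sub, Finset.sum_add_distrib, Finset.sum_sub_distrib, e1, e2, e3, e4]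
    abel
  let B : Fin n → Fin n → Fin n → Fin n → smoothPerSpace n := fun i k j l =>
    (1 / 2 : ℝ) • (b i k j l + b j l i k)
  have hB : ∀ i j, ∑ k, ∑ l, D k (D l (B i k j l)) = s i j - partialAvg n n (s i j) := by
    intro i j
    have e : ∑ k, ∑ l, D k (D l (b j l i k)) = s i j - partialAvg n n (s i j) := by
      rw [Finset.sum_comm]
      simp_rw [hDD _ _ (b _ _ _ _)]
      rw [hb, hs]
    simp only [B, map_smul, map_add, ← Finset.smul_sum, Finset.sum_add_distrib, hb, e]
    module
  choose c hc using exists_const_partialAvg (n := n)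
  refine ⟨Matrix.of fun i j => c (s i j), fun i k j l => (B i k j l).1,
    ⟨fun i k j l => (B i k j l).2, fun i k j l => ?_, fun i k j l => ?_⟩, fun x => ?_⟩
  · have : B i k l j = -B i k j l := by
      simp only [B, b]; module
    simp [this]
  · have : B j l i k = B i k j l := by
      simp only [B, b]; module
    simp [this]
  · ext i j
    have := congrFun (congrArg Subtype.val (hB i j)) x
    simp only [AddSubgroupClass.coe_sub, hc, Pi.sub_apply, Submodule.coe_sum,
      Finset.sum_apply] at this
    simp only [stress, Matrix.add_apply, Matrix.of_apply]
    exact sub_eq_iff_eq_add'.1 this.symm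

end potential

section cube

variable {n : ℕ}

lemma measurableSet_unitCube : MeasurableSet (unitCube n) :=
  MeasurableSet.univ_pi fun _ => measurableSet_Ioo

lemma volume_unitCube : volume (unitCube n) = 1 := by
  simp [unitCube, Real.volume_pi_Ioo]

lemma volume_real_unitCube : volume.real (unitCube n) = 1 := by
  simp [Measure.real, volume_unitCube]

lemma setIntegral_unitCube_const (c : ℝ) : ∫ _x in unitCube n, c = c := by
  simp [volume_real_unitCube]

lemma integrableOn_unitCube {F : (Fin n → ℝ) → ℝ} (hm : Measurable F) {K : ℝ}
    (hK : ∀ x, |F x| ≤ K) : IntegrableOn F (unitCube n) :=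
  Measure.integrableOn_of_bounded (by simp [volume_unitCube]) hm.aestronglyMeasurable
    (Filter.Eventually.of_forall hK)

lemma unitCube_subset_Icc : unitCube n ⊆ Set.Icc (0 : Fin n → ℝ) 1 :=
  fun _ hx => ⟨fun i => (hx i trivial).1.le, fun i => (hx i trivial).2.le⟩

lemma Continuous.integrableOn_unitCube {F : (Fin n → ℝ) → ℝ} (hF : Continuous F) :
    IntegrableOn F (unitCube n) :=
  (hF.continuousOn.integrableOn_compact isCompact_Icc).mono_set unitCube_subset_Icc

/-- Fubini on the unit cube, when the integral along the `i`-th direction is constant. -/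
lemma setIntegral_unitCube_of_update {F : (Fin n → ℝ) → ℝ} (hF : IntegrableOn F (unitCube n))
    (i : Fin n) (C : ℝ) (h : ∀ x, ∫ t in (0 : ℝ)..1, F (Function.update x i t) = C) :
    ∫ x in unitCube n, F x = C := by
  obtain ⟨n, rfl⟩ : ∃ m, n = m + 1 := ⟨n - 1, by have := i.2; omega⟩
  let e := MeasurableEquiv.piFinSuccAbove (fun _ : Fin (n + 1) => ℝ) i
  have he : MeasurePreserving e := volume_preserving_piFinSuccAbove (fun _ => ℝ) i
  have hpre : e ⁻¹' (Set.Ioo 0 1 ×ˢ unitCube n) = unitCube (n + 1) := by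
    ext x
    simp only [unitCube, e, Set.mem_preimage, Set.mem_prod, Set.mem_pi, Set.mem_univ, true_imp_iff,
      i.forall_iff_succAbove]
    rfl
  have h1 : ∫ x in unitCube (n + 1), F x =
      ∫ z in Set.Ioo (0 : ℝ) 1 ×ˢ unitCube n, F (e.symm z) := by
    rw [← hpre, ← he.setIntegral_preimage_emb e.measurableEmbedding]
    simp
  have h2 : IntegrableOn (fun z => F (e.symm z)) (Set.Ioo (0 : ℝ) 1 ×ˢ unitCube n) := by
    rw [← he.integrableOn_comp_preimage e.measurableEmbedding, hpre]
    simpa [Function.comp_def] using hF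
  rw [h1]
  rw [IntegrableOn, Measure.volume_eq_prod, ← Measure.prod_restrict] at h2
  rw [Measure.volume_eq_prod, ← Measure.prod_restrict, integral_prod_symm _ h2]
  have h3 : ∀ y : Fin n → ℝ, ∫ t in Set.Ioo (0 : ℝ) 1, F (e.symm (t, y)) = C := by
    intro y
    rw [← h (i.insertNth 0 y), intervalIntegral.integral_of_le zero_le_one,
      integral_Ioc_eq_integral_Ioo]
    congr 1
    ext t
    congr 1
    exact (Fin.update_insertNth (α := fun _ => ℝ) i _ _ _).symm
  simp_rw [h3]
  exact setIntegral_unitCube_const C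

lemma setIntegral_pd {f : (Fin n → ℝ) → ℝ} (hf : SmoothPer f) (k : Fin n) :
    ∫ x in unitCube n, pd k f x = 0 := by
  refine setIntegral_unitCube_of_update (hf.smooth.pd k).continuous.integrableOn_unitCube k 0
    fun x => ?_
  have hu : ∀ t, Function.update x k t = Function.update x k 0 + t • Pi.single k 1 := by
    intro t
    ext j
    by_cases hj : j = k
    · subst hj; simp
    · simp [hj]
  have := congrFun (segAvg_one_pd hf k) (Function.update x k 0)
  simp only [segAvg, one_smul, Pi.zero_apply, ← hu] at this
  exact this

lemma setIntegral_unitCube_comp_affine (F : (Fin n → ℝ) → ℝ) (c : Fin n → ℝ) {m : ℝ}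
    (hm : 0 < m) :
    ∫ y in unitCube n, F (m⁻¹ • (c + y)) =
      m ^ n * ∫ x in Set.univ.pi fun i => Set.Ioo (c i / m) ((c i + 1) / m), F x := by
  set S := Set.univ.pi fun i => Set.Ioo (c i / m) ((c i + 1) / m)
  have hS : MeasurableSet S := MeasurableSet.univ_pi fun _ => measurableSet_Ioo
  rw [← integral_indicator measurableSet_unitCube, ← integral_indicator hS]
  have h : ∀ y, (unitCube n).indicator (fun y => F (m⁻¹ • (c + y))) y =
      (fun z => S.indicator F (m⁻¹ • z)) (c + y) := by
    intro y
    have : y ∈ unitCube n ↔ m⁻¹ • (c + y) ∈ S := by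
      simp only [unitCube, S, Set.mem_pi, Set.mem_univ, true_imp_iff, Set.mem_Ioo, Pi.smul_apply,
        Pi.add_apply, smul_eq_mul]
      refine forall_congr' fun i => ?_
      rw [inv_mul_eq_div, div_lt_div_iff_of_pos_right hm, div_lt_div_iff_of_pos_right hm]
      constructor <;> rintro ⟨h1, h2⟩ <;> constructor <;> linarith
    change _ = S.indicator F (m⁻¹ • (c + y))
    by_cases hy : y ∈ unitCube n
    · rw [Set.indicator_of_mem hy, Set.indicator_of_mem (this.1 hy)]
    · rw [Set.indicator_of_notMem hy, Set.indicator_of_notMem (mt this.2 hy)]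
  simp_rw [h]
  rw [integral_add_left_eq_self (fun z => S.indicator F (m⁻¹ • z)) c,
    Measure.integral_comp_inv_smul]
  simp [abs_of_pos hm]

/-- Subdivision of the unit cube into `mⁿ` congruent cubes. -/
lemma setIntegral_unitCube_eq_sum {F : (Fin n → ℝ) → ℝ} (hF : Measurable F) {K : ℝ}
    (hK : ∀ x, |F x| ≤ K) {m : ℕ} (hm : 0 < m) :
    ∫ x in unitCube n, F x = ∑ c : Fin n → Fin m, ((m : ℝ) ^ n)⁻¹ *
      ∫ y in unitCube n, F ((m : ℝ)⁻¹ • ((fun i => ((c i : ℕ) : ℝ)) + y)) := by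
  have hm' : (0 : ℝ) < m := by exact_mod_cast hm
  let Q : (Fin n → Fin m) → Set (Fin n → ℝ) := fun c =>
    Set.univ.pi fun i => Set.Ico (((c i : ℕ) : ℝ) / m) ((((c i : ℕ) : ℝ) + 1) / m)
  have hmem : ∀ c x, x ∈ Q c ↔ ∀ i, ((c i : ℕ) : ℝ) ≤ x i * m ∧ x i * m < ((c i : ℕ) : ℝ) + 1 := by
    intro c x
    simp [Q, div_le_iff₀ hm', lt_div_iff₀ hm']
  have hQ : ∀ c, MeasurableSet (Q c) := fun c => MeasurableSet.univ_pi fun _ => measurableSet_Ico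
  have hdisj : Pairwise (Function.onFun Disjoint Q) := by
    intro c c' hcc
    refine Set.disjoint_left.2 fun x hx hx' => hcc (funext fun i => Fin.ext ?_)
    have h1 := (hmem c x).1 hx i
    have h2 := (hmem c' x).1 hx' i
    have h3 : ((c i : ℕ) : ℝ) < ((c' i : ℕ) : ℝ) + 1 := by linarith
    have h4 : ((c' i : ℕ) : ℝ) < ((c i : ℕ) : ℝ) + 1 := by linarith
    norm_cast at h3 h4
    omega
  have hU : (Set.univ.pi fun _ : Fin n => Set.Ico (0 : ℝ) 1) = ⋃ c, Q c := by
    ext x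
    simp only [Set.mem_iUnion, hmem, Set.mem_pi, Set.mem_univ, true_imp_iff, Set.mem_Ico]
    constructor
    · intro hx
      refine ⟨fun i => ⟨⌊x i * m⌋₊, ?_⟩, fun i =>
        ⟨Nat.floor_le (mul_nonneg (hx i).1 hm'.le), Nat.lt_floor_add_one _⟩⟩
      rw [Nat.floor_lt (mul_nonneg (hx i).1 hm'.le)]
      nlinarith [(hx i).2]
    · rintro ⟨c, hc⟩ i
      have h1 : ((c i : ℕ) : ℝ) + 1 ≤ m := by exact_mod_cast (c i).2
      have h0 : (0 : ℝ) ≤ ((c i : ℕ) : ℝ) := by positivity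
      constructor
      · by_contra! h
        nlinarith [hc i]
      · by_contra! h
        nlinarith [hc i]
  have hae : unitCube n =ᵐ[volume] (Set.univ.pi fun _ : Fin n => Set.Ico (0 : ℝ) 1) :=
    Measure.ae_eq_set_pi fun _ _ => Ioo_ae_eq_Ico
  have hint : IntegrableOn F (Set.univ.pi fun _ : Fin n => Set.Ico (0 : ℝ) 1) :=
    (integrableOn_unitCube hF hK).congr_set_ae hae.symm
  rw [setIntegral_congr_set hae, hU, integral_iUnion_fintype hQ hdisj fun c =>
    hint.mono_set (hU ▸ Set.subset_iUnion Q c)]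
  refine Finset.sum_congr rfl fun c _ => ?_
  rw [setIntegral_unitCube_comp_affine F _ hm', inv_mul_cancel_left₀ (by positivity)]
  exact setIntegral_congr_set (Measure.ae_eq_set_pi fun _ _ => Ioo_ae_eq_Ico).symm

lemma setIntegral_unitCube_comp_smul {F : (Fin n → ℝ) → ℝ} (hF : Measurable F) {K : ℝ}
    (hK : ∀ x, |F x| ≤ K)
    (hper : ∀ (x : Fin n → ℝ) (k : Fin n → ℤ), F (x + fun i => (k i : ℝ)) = F x)
    {m : ℕ} (hm : 0 < m) :
    ∫ y in unitCube n, F ((m : ℝ) • y) = ∫ y in unitCube n, F y := by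
  have hm' : (m : ℝ) ≠ 0 := by positivity
  rw [setIntegral_unitCube_eq_sum (F := fun y => F ((m : ℝ) • y)) (K := K)
    (hF.comp (measurable_const_smul (m : ℝ))) (fun x => hK _) hm]
  have : ∀ (c : Fin n → Fin m) (y : Fin n → ℝ),
      F ((m : ℝ) • (m : ℝ)⁻¹ • ((fun i => ((c i : ℕ) : ℝ)) + y)) = F y := by
    intro c y
    rw [smul_inv_smul₀ hm', add_comm, ← hper y fun i => (c i : ℤ)]
    simp
  simp_rw [this]
  simp [hm']

end cube

section kohnStrang

variable {n : ℕ} {α β : ℝ}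

lemma frobSq_nonneg (A : Matrix (Fin n) (Fin n) ℝ) : 0 ≤ frobSq A :=
  Finset.sum_nonneg fun _ _ => Finset.sum_nonneg fun _ _ => sq_nonneg _

lemma frobSq_le {A : Matrix (Fin n) (Fin n) ℝ} {M : ℝ} (h : ∀ i j, |A i j| ≤ M) :
    frobSq A ≤ n ^ 2 * M ^ 2 := by
  calc frobSq A ≤ ∑ _i : Fin n, ∑ _j : Fin n, M ^ 2 :=
        Finset.sum_le_sum fun i _ => Finset.sum_le_sum fun j _ => by
          rw [← sq_abs]; exact pow_le_pow_left₀ (abs_nonneg _) (h i j) 2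
    _ = n ^ 2 * M ^ 2 := by simp; ring

lemma kohnStrang_zero : kohnStrang α β (0 : Matrix (Fin n) (Fin n) ℝ) = 0 := by
  simp [kohnStrang]

lemma kohnStrang_of_ne {A : Matrix (Fin n) (Fin n) ℝ} (h : A ≠ 0) :
    kohnStrang α β A = α * frobSq A + β := by
  simp [kohnStrang, h]

lemma kohnStrang_nonneg (hα : 0 < α) (hβ : 0 < β) (A : Matrix (Fin n) (Fin n) ℝ) :
    0 ≤ kohnStrang α β A := by
  by_cases h : A = 0
  · rw [h, kohnStrang_zero]
  · rw [kohnStrang_of_ne h]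
    have := frobSq_nonneg A
    positivity

lemma kohnStrang_le (hα : 0 < α) (hβ : 0 < β) (A : Matrix (Fin n) (Fin n) ℝ) :
    kohnStrang α β A ≤ α * frobSq A + β := by
  by_cases h : A = 0
  · rw [h, kohnStrang_zero]
    have := frobSq_nonneg (0 : Matrix (Fin n) (Fin n) ℝ)
    positivity
  · rw [kohnStrang_of_ne h]

lemma kohnStrang_le_of_abs_le (hα : 0 < α) (hβ : 0 < β) {A : Matrix (Fin n) (Fin n) ℝ} {M : ℝ}
    (h : ∀ i j, |A i j| ≤ M) : kohnStrang α β A ≤ α * (n ^ 2 * M ^ 2) + β :=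
  (kohnStrang_le hα hβ A).trans (by gcongr; exact frobSq_le h)

lemma abs_kohnStrang_le_of_abs_le (hα : 0 < α) (hβ : 0 < β) {A : Matrix (Fin n) (Fin n) ℝ} {M : ℝ}
    (h : ∀ i j, |A i j| ≤ M) : |kohnStrang α β A| ≤ α * (n ^ 2 * M ^ 2) + β := by
  rw [abs_of_nonneg (kohnStrang_nonneg hα hβ A)]
  exact kohnStrang_le_of_abs_le hα hβ h

lemma frobSq_add_le {δ : ℝ} (hδ : 0 < δ) (A B : Matrix (Fin n) (Fin n) ℝ) :
    frobSq (A + B) ≤ (1 + δ) * frobSq A + (1 + δ⁻¹) * frobSq B := by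
  simp only [frobSq, Finset.mul_sum, ← Finset.sum_add_distrib]
  refine Finset.sum_le_sum fun i _ => Finset.sum_le_sum fun j _ => ?_
  rw [Matrix.add_apply]
  have h : 0 ≤ (δ * A i j - B i j) ^ 2 * δ⁻¹ := by positivity
  have e : (δ * A i j - B i j) ^ 2 * δ⁻¹ =
      δ * A i j ^ 2 - 2 * (A i j * B i j) + δ⁻¹ * B i j ^ 2 := by
    field_simp
    ring
  nlinarith

lemma kohnStrang_add_le (hα : 0 < α) (hβ : 0 < β) {δ : ℝ} (hδ : 0 < δ)
    (A B : Matrix (Fin n) (Fin n) ℝ) :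
    kohnStrang α β (A + B) ≤ (1 + δ) * kohnStrang α β A + (1 + δ⁻¹) * kohnStrang α β B := by
  have hδ' : 0 < δ⁻¹ := inv_pos.2 hδ
  have hA' := kohnStrang_nonneg hα hβ A
  have hB' := kohnStrang_nonneg hα hβ B
  by_cases hA : A = 0
  · subst hA
    rw [zero_add, kohnStrang_zero]
    nlinarith [mul_nonneg hδ'.le hB']
  by_cases hB : B = 0
  · subst hB
    rw [add_zero, kohnStrang_zero]
    nlinarith [mul_nonneg hδ.le hA']
  rw [kohnStrang_of_ne hA, kohnStrang_of_ne hB]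
  have h1 := kohnStrang_le hα hβ (A + B)
  have h2 := mul_le_mul_of_nonneg_left (frobSq_add_le hδ A B) hα.le
  have h3 := mul_pos hδ hβ
  have h4 := mul_pos hδ' hβ
  linarith

lemma measurable_kohnStrang_comp {φ : (Fin n → ℝ) → Matrix (Fin n) (Fin n) ℝ}
    (hφ : ∀ i j, Continuous fun x => φ x i j) : Measurable fun x => kohnStrang α β (φ x) := by
  classical
  have hS : MeasurableSet {x | φ x = 0} := by
    have : {x | φ x = 0} = ⋂ i, ⋂ j, {x | φ x i j = 0} := by
      ext x
      simp [← Matrix.ext_iff]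
    rw [this]
    exact .iInter fun i => .iInter fun j => (isClosed_singleton.preimage (hφ i j)).measurableSet
  have hf : Measurable fun x => frobSq (φ x) := by
    refine Continuous.measurable ?_
    unfold frobSq
    fun_prop
  have : (fun x => kohnStrang α β (φ x)) =
      {x | φ x = 0}.piecewise (fun _ => 0) fun x => α * frobSq (φ x) + β := by
    ext x
    by_cases h : φ x = 0
    · rw [Set.piecewise_eq_of_mem _ _ _ (show x ∈ {x | φ x = 0} from h), h, kohnStrang_zero]
    · rw [Set.piecewise_eq_of_notMem _ _ _ (show x ∉ {x | φ x = 0} from h), kohnStrang_of_ne h]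
  rw [this]
  exact Measurable.piecewise hS measurable_const ((hf.const_mul α).add_const β)

end kohnStrang

section stress

variable {n : ℕ} {B C : Fin n → Fin n → Fin n → Fin n → (Fin n → ℝ) → ℝ}

lemma stress_apply (B : Fin n → Fin n → Fin n → Fin n → (Fin n → ℝ) → ℝ) (x : Fin n → ℝ)
    (i j : Fin n) : stress B x i j = ∑ k, ∑ l, pd k (pd l (B i k j l)) x := rfl

lemma stress_add (hB : ∀ i k j l, ContDiff ℝ (⊤ : ℕ∞) (B i k j l))
    (hC : ∀ i k j l, ContDiff ℝ (⊤ : ℕ∞) (C i k j l)) (x : Fin n → ℝ) :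
    stress (B + C) x = stress B x + stress C x := by
  ext i j
  simp only [Matrix.add_apply, stress_apply, ← Finset.sum_add_distrib, Pi.add_apply]
  refine Finset.sum_congr rfl fun k _ => Finset.sum_congr rfl fun l _ => ?_
  rw [pd_add l (hB _ _ _ _) (hC _ _ _ _), pd_add k ((hB _ _ _ _).pd l) ((hC _ _ _ _).pd l)]
  rfl

lemma stress_smul (c : ℝ) (hB : ∀ i k j l, ContDiff ℝ (⊤ : ℕ∞) (B i k j l)) (x : Fin n → ℝ) :
    stress (c • B) x = c • stress B x := by
  ext i j
  simp only [Matrix.smul_apply, stress_apply, Finset.smul_sum, Pi.smul_apply]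
  refine Finset.sum_congr rfl fun k _ => Finset.sum_congr rfl fun l _ => ?_
  rw [pd_smul l c (hB _ _ _ _), pd_smul k c ((hB _ _ _ _).pd l)]
  rfl

lemma stress_sub (hB : ∀ i k j l, ContDiff ℝ (⊤ : ℕ∞) (B i k j l))
    (hC : ∀ i k j l, ContDiff ℝ (⊤ : ℕ∞) (C i k j l)) (x : Fin n → ℝ) :
    stress (B - C) x = stress B x - stress C x := by
  ext i j
  simp only [Matrix.sub_apply, stress_apply, ← Finset.sum_sub_distrib, Pi.sub_apply]
  refine Finset.sum_congr rfl fun k _ => Finset.sum_congr rfl fun l _ => ?_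
  rw [pd_sub l (hB _ _ _ _) (hC _ _ _ _), pd_sub k ((hB _ _ _ _).pd l) ((hC _ _ _ _).pd l)]
  rfl

lemma stress_zero (x : Fin n → ℝ) :
    stress (0 : Fin n → Fin n → Fin n → Fin n → (Fin n → ℝ) → ℝ) x = 0 := by
  ext i j
  simp [stress_apply, pd_zero]

lemma stress_comp_affine (hB : ∀ i k j l, ContDiff ℝ (⊤ : ℕ∞) (B i k j l)) (p : Fin n → ℝ)
    {s : ℝ} (hs : s ≠ 0) (y : Fin n → ℝ) :
    stress (fun i k j l y => (s ^ 2)⁻¹ * B i k j l (p + s • y)) y = stress B (p + s • y) := by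
  ext i j
  simp only [stress_apply]
  refine Finset.sum_congr rfl fun k _ => Finset.sum_congr rfl fun l _ => ?_
  have hc : ∀ f : (Fin n → ℝ) → ℝ, ContDiff ℝ (⊤ : ℕ∞) f →
      ContDiff ℝ (⊤ : ℕ∞) fun y => f (p + s • y) := fun f hf =>
    hf.comp (by fun_prop)
  have e1 : pd l (fun y => (s ^ 2)⁻¹ * B i k j l (p + s • y)) =
      ((s ^ 2)⁻¹ * s) • fun y => pd l (B i k j l) (p + s • y) := by
    change pd l ((s ^ 2)⁻¹ • fun y => B i k j l (p + s • y)) = _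
    rw [pd_smul l _ (hc _ (hB _ _ _ _)), pd_comp_affine l (hB _ _ _ _)]
    ext y; simp [mul_assoc]
  rw [e1, pd_smul k _ (hc _ ((hB _ _ _ _).pd l)), pd_comp_affine k ((hB _ _ _ _).pd l)]
  simp only [Pi.smul_apply, smul_eq_mul]
  field_simp

lemma stress_congr {x : Fin n → ℝ} (h : ∀ i k j l, B i k j l =ᶠ[nhds x] C i k j l) :
    stress B x = stress C x := by
  ext i j
  simp only [stress_apply]
  exact Finset.sum_congr rfl fun k _ => Finset.sum_congr rfl fun l _ =>
    (pd_congr_of_eventuallyEq k (pd_congr_of_eventuallyEq l (h i k j l))).eq_of_nhds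

namespace IsPot

lemma smooth (hB : IsPot B) (i k j l : Fin n) : ContDiff ℝ (⊤ : ℕ∞) (B i k j l) :=
  (hB.smoothPer i k j l).smooth

lemma zero : IsPot (0 : Fin n → Fin n → Fin n → Fin n → (Fin n → ℝ) → ℝ) :=
  ⟨fun _ _ _ _ => SmoothPer.const 0, fun _ _ _ _ => by simp, fun _ _ _ _ => by simp⟩

lemma add (hB : IsPot B) (hC : IsPot C) : IsPot (B + C) :=
  ⟨fun i k j l => (hB.smoothPer i k j l).add (hC.smoothPer i k j l),
    fun i k j l => by simp only [Pi.add_apply, hB.anti i k j l, hC.anti i k j l]; abel,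
    fun i k j l => by simp only [Pi.add_apply, hB.symm i k j l, hC.symm i k j l]⟩

lemma smul (c : ℝ) (hB : IsPot B) : IsPot (c • B) :=
  ⟨fun i k j l => (hB.smoothPer i k j l).smul c,
    fun i k j l => by simp only [Pi.smul_apply, hB.anti i k j l, smul_neg],
    fun i k j l => by simp only [Pi.smul_apply, hB.symm i k j l]⟩

lemma smoothPer_stress (hB : IsPot B) (i j : Fin n) : SmoothPer fun x => stress B x i j := by
  have h : ∀ k l, SmoothPer (_root_.pd k (_root_.pd l (B i k j l))) := fun k l =>
    ((hB.smoothPer i k j l).pd l).pd k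
  refine ⟨?_, fun x z => ?_⟩
  · simp only [stress_apply]
    exact ContDiff.sum fun k _ => ContDiff.sum fun l _ => (h k l).smooth
  · simp only [stress_apply, (h _ _).per]

end IsPot

/-- A common bound for finitely many smooth periodic functions. -/
lemma exists_common_bound {ι : Type*} [Fintype ι] {F : ι → (Fin n → ℝ) → ℝ}
    (hF : ∀ a, SmoothPer (F a)) : ∃ M, 0 ≤ M ∧ ∀ a x, |F a x| ≤ M := by
  choose M hM using fun a => (hF a).exists_bound
  refine ⟨∑ a, |M a|, by positivity, fun a x => (hM a x).trans ((le_abs_self _).trans ?_)⟩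
  exact Finset.single_le_sum (f := fun a => |M a|) (fun a _ => abs_nonneg _) (Finset.mem_univ a)

lemma IsPot.setIntegral_stress (hB : IsPot B) (i j : Fin n) :
    ∫ x in unitCube n, stress B x i j = 0 := by
  have h : ∀ k l, SmoothPer (pd k (pd l (B i k j l))) := fun k l =>
    ((hB.smoothPer i k j l).pd l).pd k
  simp only [stress_apply]
  rw [integral_finsetSum _ fun k _ => integrable_finsetSum _ fun l _ =>
    (h k l).smooth.continuous.integrableOn_unitCube]
  refine Finset.sum_eq_zero fun k _ => ?_
  rw [integral_finsetSum _ fun l _ => (h k l).smooth.continuous.integrableOn_unitCube]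
  exact Finset.sum_eq_zero fun l _ => setIntegral_pd ((hB.smoothPer i k j l).pd l) k

lemma IsPot.admissible (hB : IsPot B) {A : Matrix (Fin n) (Fin n) ℝ} (hA : A.IsSymm) :
    Admissible fun x => A + stress B x := by
  have hs : ∀ i j, SmoothPer fun x => stress B x i j := hB.smoothPer_stress
  refine ⟨fun i j => ?_, fun x k => ?_, fun x => ?_, fun x i => ?_⟩
  · exact contDiff_const.add (hs i j).smooth
  · ext i j
    simp only [Matrix.add_apply]
    rw [(hs i j).per x k]
  · refine hA.add ?_
    ext i j
    rw [Matrix.transpose_apply, stress_apply, stress_apply, Finset.sum_comm]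
    refine Finset.sum_congr rfl fun k _ => Finset.sum_congr rfl fun l _ => ?_
    rw [pd_comm _ _ (hB.smooth _ _ _ _), hB.symm]
  · have h3 : ∀ k j l, ContDiff ℝ (⊤ : ℕ∞) (pd k (pd l (B i k j l))) := fun k j l =>
      ((hB.smooth i k j l).pd l).pd k
    have e : ∀ j, fderiv ℝ (fun y => (A + stress B y) i j) x (Pi.single j 1) =
        ∑ k, ∑ l, pd j (pd k (pd l (B i k j l))) x := by
      intro j
      have : (fun y => (A + stress B y) i j) =
          (fun _ => A i j) + ∑ k, ∑ l, pd k (pd l (B i k j l)) := by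
        ext y
        simp [stress_apply]
      change pd j _ x = _
      have h4 : ∀ k, ContDiff ℝ (⊤ : ℕ∞) (∑ l, pd k (pd l (B i k j l))) := fun k => by
        rw [show (∑ l, pd k (pd l (B i k j l))) = fun y => ∑ l, pd k (pd l (B i k j l)) y by
          ext; simp]
        exact ContDiff.sum fun l _ => h3 k j l
      have h5 : ContDiff ℝ (⊤ : ℕ∞) (∑ k, ∑ l, pd k (pd l (B i k j l))) := by
        rw [show (∑ k, ∑ l, pd k (pd l (B i k j l))) =
          fun y => ∑ k, (∑ l, pd k (pd l (B i k j l))) y by ext; simp]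
        exact ContDiff.sum fun k _ => h4 k
      rw [this, pd_add j contDiff_const h5, pd_const, zero_add, pd_sum _ _ h4]
      simp_rw [pd_sum _ _ fun l => h3 _ j l]
      simp
    simp_rw [e]
    rw [Finset.sum_comm]
    refine Finset.sum_eq_zero fun k _ => ?_
    have h6 : ∀ j l, pd j (pd k (pd l (B i k j l))) x = -pd l (pd k (pd j (B i k l j))) x := by
      intro j l
      have hs := hB.smooth i k j l
      rw [hB.anti i k j l, pd_neg, pd_neg, pd_neg, Pi.neg_apply, neg_neg,
        pd_comm k l hs, pd_comm j l (hs.pd k), pd_comm j k hs]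
    have h7 : ∑ j, ∑ l, pd j (pd k (pd l (B i k j l))) x =
        -∑ j, ∑ l, pd j (pd k (pd l (B i k j l))) x := by
      conv_lhs => rw [Finset.sum_comm]
      simp only [← Finset.sum_neg_distrib]
      exact Finset.sum_congr rfl fun l _ => Finset.sum_congr rfl fun j _ => h6 j l
    linarith

end stress

section envelope

variable {n : ℕ} {α β : ℝ} {A A' : Matrix (Fin n) (Fin n) ℝ}
  {B : Fin n → Fin n → Fin n → Fin n → (Fin n → ℝ) → ℝ}

lemma Admissible.exists_eq_mean_add_stress {φ : (Fin n → ℝ) → Matrix (Fin n) (Fin n) ℝ}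
    (hφ : Admissible φ) : ∃ B : Fin n → Fin n → Fin n → Fin n → (Fin n → ℝ) → ℝ, IsPot B ∧
      ∀ x, φ x = (Matrix.of fun i j => ∫ y in unitCube n, φ y i j) + stress B x := by
  obtain ⟨A, B, hB, h⟩ := exists_isPot hφ
  refine ⟨B, hB, fun x => ?_⟩
  have hA : A = Matrix.of fun i j => ∫ y in unitCube n, φ y i j := by
    ext i j
    simp only [Matrix.of_apply, h, Matrix.add_apply]
    rw [integral_add (continuous_const.integrableOn_unitCube)
      (hB.smoothPer_stress i j).smooth.continuous.integrableOn_unitCube, hB.setIntegral_stress,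
      setIntegral_unitCube_const, add_zero]
  rw [← hA, h]

lemma IsPot.exists_abs_stress_le (hB : IsPot B) : ∃ M, 0 ≤ M ∧ ∀ x i j, |stress B x i j| ≤ M := by
  obtain ⟨M, h0, hM⟩ := exists_common_bound (F := fun (p : Fin n × Fin n) x => stress B x p.1 p.2)
    fun p => hB.smoothPer_stress p.1 p.2
  exact ⟨M, h0, fun x i j => hM (i, j) x⟩

lemma IsPot.measurable_kohnStrang (hB : IsPot B) (A : Matrix (Fin n) (Fin n) ℝ) :
    Measurable fun x => kohnStrang α β (A + stress B x) :=
  measurable_kohnStrang_comp fun i j =>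
    continuous_const.add (hB.smoothPer_stress i j).smooth.continuous

lemma IsPot.exists_abs_kohnStrang_le (hα : 0 < α) (hβ : 0 < β) (hB : IsPot B)
    (A : Matrix (Fin n) (Fin n) ℝ) : ∃ K, ∀ x, |kohnStrang α β (A + stress B x)| ≤ K := by
  obtain ⟨M, -, hM⟩ := hB.exists_abs_stress_le
  obtain ⟨M', -, hM'⟩ := exists_common_bound (n := n) (F := fun (p : Fin n × Fin n) _ => A p.1 p.2)
    fun p => SmoothPer.const _
  refine ⟨_, fun x => abs_kohnStrang_le_of_abs_le hα hβ (M := M' + M) fun i j => ?_⟩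
  exact (abs_add_le _ _).trans (add_le_add (hM' (i, j) 0) (hM x i j))

lemma IsPot.integrableOn_kohnStrang (hα : 0 < α) (hβ : 0 < β) (hB : IsPot B)
    (A : Matrix (Fin n) (Fin n) ℝ) :
    IntegrableOn (fun x => kohnStrang α β (A + stress B x)) (unitCube n) :=
  integrableOn_unitCube (hB.measurable_kohnStrang A)
    (hB.exists_abs_kohnStrang_le hα hβ A).choose_spec

lemma QdivKohnStrang_le (hα : 0 < α) (hβ : 0 < β) (hA : A.IsSymm) (hB : IsPot B) :
    QdivKohnStrang n α β A ≤ ∫ x in unitCube n, kohnStrang α β (A + stress B x) := by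
  refine csInf_le ⟨0, ?_⟩ ⟨_, hB.admissible hA, fun i j => ?_, rfl⟩
  · rintro v ⟨φ, -, -, rfl⟩
    exact integral_nonneg fun x => kohnStrang_nonneg hα hβ _
  · simp only [Matrix.add_apply]
    rw [integral_add (continuous_const.integrableOn_unitCube)
      (hB.smoothPer_stress i j).smooth.continuous.integrableOn_unitCube, hB.setIntegral_stress,
      setIntegral_unitCube_const, add_zero]

lemma exists_isPot_setIntegral_le (hA : A.IsSymm) {ε : ℝ} (hε : 0 < ε) :
    ∃ B : Fin n → Fin n → Fin n → Fin n → (Fin n → ℝ) → ℝ, IsPot B ∧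
      ∫ x in unitCube n, kohnStrang α β (A + stress B x) ≤ QdivKohnStrang n α β A + ε := by
  have hne : {v : ℝ | ∃ φ : (Fin n → ℝ) → Matrix (Fin n) (Fin n) ℝ,
      Admissible φ ∧ (∀ i j, (∫ x in unitCube n, φ x i j) = A i j) ∧
      v = ∫ x in unitCube n, kohnStrang α β (φ x)}.Nonempty := by
    refine ⟨_, _, IsPot.zero.admissible hA, fun i j => ?_, rfl⟩
    simp only [stress_zero, add_zero]
    exact setIntegral_unitCube_const _
  obtain ⟨_, ⟨φ, hφ, hm, rfl⟩, hv⟩ := Real.lt_sInf_add_pos hne hε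
  obtain ⟨B, hB, h⟩ := hφ.exists_eq_mean_add_stress
  refine ⟨B, hB, ?_⟩
  have hA' : (Matrix.of fun i j => ∫ y in unitCube n, φ y i j) = A := by
    ext i j; exact hm i j
  rw [hA'] at h
  simp_rw [← h]
  exact hv.le

lemma QdivKohnStrang_nonneg (hα : 0 < α) (hβ : 0 < β) (A : Matrix (Fin n) (Fin n) ℝ) :
    0 ≤ QdivKohnStrang n α β A := by
  refine Real.sInf_nonneg ?_
  rintro v ⟨φ, -, -, rfl⟩
  exact integral_nonneg fun x => kohnStrang_nonneg hα hβ _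

lemma QdivKohnStrang_le_kohnStrang (hα : 0 < α) (hβ : 0 < β) (hA : A.IsSymm) :
    QdivKohnStrang n α β A ≤ kohnStrang α β A := by
  have := QdivKohnStrang_le hα hβ hA IsPot.zero
  simpa only [stress_zero, add_zero, setIntegral_unitCube_const] using this

lemma setIntegral_kohnStrang_add_le (hα : 0 < α) (hβ : 0 < β) {δ : ℝ} (hδ : 0 < δ)
    {C : Fin n → Fin n → Fin n → Fin n → (Fin n → ℝ) → ℝ} (hB : IsPot B) (hC : IsPot C) :
    ∫ x in unitCube n, kohnStrang α β (A + A' + stress (B + C) x) ≤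
      (1 + δ) * (∫ x in unitCube n, kohnStrang α β (A + stress B x)) +
      (1 + δ⁻¹) * ∫ x in unitCube n, kohnStrang α β (A' + stress C x) := by
  have h1 := hB.integrableOn_kohnStrang hα hβ A
  have h2 := hC.integrableOn_kohnStrang hα hβ A'
  rw [← integral_const_mul, ← integral_const_mul, ← integral_add (h1.const_mul _) (h2.const_mul _)]
  refine integral_mono ((hB.add hC).integrableOn_kohnStrang hα hβ _)
    ((h1.const_mul _).add (h2.const_mul _)) fun x => ?_
  have e : A + A' + stress (B + C) x = (A + stress B x) + (A' + stress C x) := by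
    rw [stress_add hB.smooth hC.smooth]; abel
  simp only [e]
  exact kohnStrang_add_le hα hβ hδ _ _

lemma QdivKohnStrang_add_le (hα : 0 < α) (hβ : 0 < β) {δ : ℝ} (hδ : 0 < δ)
    (hA : A.IsSymm) (hA' : A'.IsSymm) :
    QdivKohnStrang n α β (A + A') ≤
      (1 + δ) * QdivKohnStrang n α β A + (1 + δ⁻¹) * QdivKohnStrang n α β A' := by
  have hδ' : 0 < δ⁻¹ := inv_pos.2 hδ
  refine le_of_forall_pos_le_add fun ε hε => ?_
  obtain ⟨B, hB, h1⟩ := exists_isPot_setIntegral_le (α := α) (β := β) hA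
    (show 0 < ε / 2 / (1 + δ) by positivity)
  obtain ⟨C, hC, h2⟩ := exists_isPot_setIntegral_le (α := α) (β := β) hA'
    (show 0 < ε / 2 / (1 + δ⁻¹) by positivity)
  refine (QdivKohnStrang_le hα hβ (hA.add hA') (hB.add hC)).trans
    ((setIntegral_kohnStrang_add_le hα hβ hδ hB hC).trans ?_)
  have h1' := mul_le_mul_of_nonneg_left h1 (by positivity : 0 ≤ 1 + δ)
  have h2' := mul_le_mul_of_nonneg_left h2 (by positivity : 0 ≤ 1 + δ⁻¹)
  rw [mul_add, mul_div_cancel₀ _ (by positivity)] at h1' h2'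
  linarith

/-- There is a corrector for the mean value `A`, with bounds `M`, whose average energy is at most
`v`. -/
def HasCorrector (α β M : ℝ) (A : Matrix (Fin n) (Fin n) ℝ) (v : ℝ) : Prop :=
  ∃ B : Fin n → Fin n → Fin n → Fin n → (Fin n → ℝ) → ℝ, IsPot B ∧
    (∀ i k j l x, |B i k j l x| ≤ M) ∧ (∀ a i k j l x, |pd a (B i k j l) x| ≤ M) ∧
    (∀ x i j, |stress B x i j| ≤ M) ∧
    ∫ x in unitCube n, kohnStrang α β (A + stress B x) ≤ v

lemma HasCorrector.mono {M M' v v' : ℝ} (h : HasCorrector α β M A v) (hM : M ≤ M') (hv : v ≤ v') :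
    HasCorrector α β M' A v' := by
  obtain ⟨B, hB, h1, h2, h3, h4⟩ := h
  exact ⟨B, hB, fun i k j l x => (h1 i k j l x).trans hM, fun a i k j l x =>
    (h2 a i k j l x).trans hM, fun x i j => (h3 x i j).trans hM, h4.trans hv⟩

lemma HasCorrector.add (hα : 0 < α) (hβ : 0 < β) {M M' v v' δ : ℝ} (hδ : 0 < δ)
    (h : HasCorrector α β M A v) (h' : HasCorrector α β M' A' v') :
    HasCorrector α β (M + M') (A + A') ((1 + δ) * v + (1 + δ⁻¹) * v') := by
  have hδ' : 0 < δ⁻¹ := inv_pos.2 hδ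
  obtain ⟨B, hB, h1, h2, h3, h4⟩ := h
  obtain ⟨C, hC, h1', h2', h3', h4'⟩ := h'
  refine ⟨B + C, hB.add hC, fun i k j l x => ?_, fun a i k j l x => ?_, fun x i j => ?_, ?_⟩
  · exact (abs_add_le _ _).trans (add_le_add (h1 i k j l x) (h1' i k j l x))
  · simp only [Pi.add_apply]
    rw [pd_add a (hB.smooth i k j l) (hC.smooth i k j l)]
    exact (abs_add_le _ _).trans (add_le_add (h2 a i k j l x) (h2' a i k j l x))
  · rw [stress_add hB.smooth hC.smooth]
    exact (abs_add_le _ _).trans (add_le_add (h3 x i j) (h3' x i j))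
  · refine (setIntegral_kohnStrang_add_le hα hβ hδ hB hC).trans ?_
    gcongr

lemma IsPot.exists_bounds (hB : IsPot B) : ∃ M, (∀ i k j l x, |B i k j l x| ≤ M) ∧
    (∀ a i k j l x, |pd a (B i k j l) x| ≤ M) ∧ ∀ x i j, |stress B x i j| ≤ M := by
  obtain ⟨M1, -, h1⟩ := exists_common_bound
    (F := fun (p : Fin n × Fin n × Fin n × Fin n) => B p.1 p.2.1 p.2.2.1 p.2.2.2)
    fun p => hB.smoothPer _ _ _ _
  obtain ⟨M2, -, h2⟩ := exists_common_bound
    (F := fun (p : Fin n × Fin n × Fin n × Fin n × Fin n) =>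
      pd p.1 (B p.2.1 p.2.2.1 p.2.2.2.1 p.2.2.2.2))
    fun p => (hB.smoothPer _ _ _ _).pd _
  obtain ⟨M3, -, h3⟩ := hB.exists_abs_stress_le
  exact ⟨max M1 (max M2 M3),
    fun i k j l x => (h1 (i, k, j, l) x).trans (le_max_left _ _),
    fun a i k j l x => (h2 (a, i, k, j, l) x).trans ((le_max_left _ _).trans (le_max_right _ _)),
    fun x i j => (h3 x i j).trans ((le_max_right _ _).trans (le_max_right _ _))⟩

lemma exists_hasCorrector (hA : A.IsSymm) {ε : ℝ} (hε : 0 < ε) :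
    ∃ M, HasCorrector α β M A (QdivKohnStrang n α β A + ε) := by
  obtain ⟨B, hB, h⟩ := exists_isPot_setIntegral_le (α := α) (β := β) hA hε
  obtain ⟨M, h1, h2, h3⟩ := hB.exists_bounds
  exact ⟨M, B, hB, h1, h2, h3, h⟩

lemma QdivKohnStrang_le_of_hasCorrector (hα : 0 < α) (hβ : 0 < β) (hA : A.IsSymm) {M v : ℝ}
    (h : HasCorrector α β M A v) : QdivKohnStrang n α β A ≤ v := by
  obtain ⟨B, hB, -, -, -, h4⟩ := h
  exact (QdivKohnStrang_le hα hβ hA hB).trans h4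

end envelope

section lamination

variable {n : ℕ} {α β : ℝ}

/-- A smooth periodic profile with mean one, concentrated near the integers. -/
lemma exists_concentrated_profile {θ : ℝ} (hθ : 0 < θ) (hθ' : θ < 1) :
    ∃ f : ℝ → ℝ, ContDiff ℝ (⊤ : ℕ∞) f ∧ Function.Periodic f 1 ∧ ∫ t in (0 : ℝ)..1, f t = 1 ∧
      ∀ t ∈ Set.Icc (θ / 2) (1 - θ / 2), f t = 0 := by
  let g : ℝ → ℝ := fun t =>
    Real.smoothTransition (Real.cos (2 * Real.pi * t) - Real.cos (Real.pi * θ))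
  have hg : ContDiff ℝ (⊤ : ℕ∞) g := Real.smoothTransition.contDiff.comp (by fun_prop)
  have hper : Function.Periodic g 1 := fun t => by
    simp only [g]
    rw [show 2 * Real.pi * (t + 1) = 2 * Real.pi * t + 2 * Real.pi by ring, Real.cos_add_two_pi]
  have hpi := Real.pi_pos
  have hlt : Real.cos (Real.pi * θ) < 1 := by
    rw [← Real.cos_zero]
    exact Real.cos_lt_cos_of_nonneg_of_le_pi le_rfl (by nlinarith) (by positivity)
  have hpos : 0 < ∫ t in (0 : ℝ)..1, g t := by
    refine intervalIntegral.integral_pos zero_lt_one hg.continuous.continuousOn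
      (fun t _ => Real.smoothTransition.nonneg _) ⟨0, by simp, ?_⟩
    exact Real.smoothTransition.pos_of_pos (by simpa using hlt)
  have hzero : ∀ t ∈ Set.Icc (θ / 2) (1 - θ / 2), g t = 0 := by
    rintro t ⟨h1, h2⟩
    refine Real.smoothTransition.zero_of_nonpos (sub_nonpos.2 ?_)
    rcases le_total t (1 / 2) with h | h
    · exact Real.cos_le_cos_of_nonneg_of_le_pi (by positivity) (by nlinarith) (by nlinarith)
    · rw [← Real.cos_two_pi_sub (2 * Real.pi * t)]
      exact Real.cos_le_cos_of_nonneg_of_le_pi (by positivity) (by nlinarith) (by nlinarith)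
  refine ⟨fun t => (∫ t in (0 : ℝ)..1, g t)⁻¹ * g t, contDiff_const.mul hg, fun t => ?_, ?_,
    fun t ht => ?_⟩
  · simp only [hper t]
  · rw [intervalIntegral.integral_const_mul, inv_mul_cancel₀ hpos.ne']
  · simp only [hzero t ht, mul_zero]

lemma setIntegral_unitCube_comp_int_linear {H : ℝ → ℝ} (hper : Function.Periodic H 1)
    (hm : Measurable H) {K : ℝ} (hK : ∀ t, |H t| ≤ K) (ξ : Fin n → ℤ) (i : Fin n) (hi : ξ i = 1) :
    ∫ x in unitCube n, H (∑ a, ξ a * x a) = ∫ t in (0 : ℝ)..1, H t := by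
  refine setIntegral_unitCube_of_update (integrableOn_unitCube (K := K) (hm.comp (by fun_prop))
    fun x => hK _) i _ fun x => ?_
  have h : ∀ t, ∑ a, (ξ a : ℝ) * Function.update x i t a =
      (∑ a ∈ Finset.univ.erase i, (ξ a : ℝ) * x a) + t := by
    intro t
    rw [← Finset.add_sum_erase _ _ (Finset.mem_univ i), Function.update_self, hi, add_comm]
    simp only [Int.cast_one, one_mul]
    congr 1
    refine Finset.sum_congr rfl fun a ha => ?_
    rw [Function.update_of_ne (Finset.ne_of_mem_erase ha)]
  simp_rw [Function.comp_apply, h]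
  rw [intervalIntegral.integral_comp_add_left (fun t => H t)]
  simpa [add_comm, add_assoc] using
    hper.intervalIntegral_add_eq ((∑ a ∈ Finset.univ.erase i, (ξ a : ℝ) * x a)) 0

lemma kohnStrang_smul_le (hα : 0 < α) (hβ : 0 < β) (c t : ℝ) {K : ℝ} (ht : |t| ≤ K)
    (E : Matrix (Fin n) (Fin n) ℝ) :
    kohnStrang α β (c • t • E) ≤ α * (c ^ 2 * (K ^ 2 * frobSq E)) + if t = 0 then 0 else β := by
  have hE := frobSq_nonneg E
  split_ifs with h
  · rw [h, zero_smul, smul_zero, kohnStrang_zero]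
    positivity
  · refine (kohnStrang_le hα hβ _).trans ?_
    have e : frobSq (c • t • E) = c ^ 2 * (t ^ 2 * frobSq E) := by
      simp only [frobSq, Matrix.smul_apply, smul_eq_mul, Finset.mul_sum]
      exact Finset.sum_congr rfl fun i _ => Finset.sum_congr rfl fun j _ => by ring
    rw [e]
    have : t ^ 2 ≤ K ^ 2 := by rw [← sq_abs]; exact pow_le_pow_left₀ (abs_nonneg _) ht 2
    gcongr

/-- Laminates in direction `ξ` of multiples of `v ⊗ v`, where `v ⊥ ξ`, have small energy. -/
lemma exists_hasCorrector_smul_vecMulVec (hα : 0 < α) (hβ : 0 < β) (v : Fin n → ℝ)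
    (ξ : Fin n → ℤ) (i : Fin n) (hi : ξ i = 1) (hv : ∑ a, ξ a * v a = 0) {ε : ℝ} (hε : 0 < ε) :
    ∃ δ > 0, ∃ M, ∀ c : ℝ, |c| < δ → HasCorrector α β M (c • Matrix.vecMulVec v v) ε := by
  set E := Matrix.vecMulVec v v
  obtain ⟨θ, h0, h1, hθε⟩ : ∃ θ : ℝ, 0 < θ ∧ θ < 1 ∧ β * θ ≤ ε / 2 := by
    refine ⟨min (1 / 2) (ε / 2 / β), by positivity, (min_le_left _ _).trans_lt (by norm_num), ?_⟩
    calc β * min (1 / 2) (ε / 2 / β) ≤ β * (ε / 2 / β) := by gcongr; exact min_le_right _ _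
      _ = ε / 2 := by field_simp
  obtain ⟨f, hf, hper, hint, hzero⟩ := exists_concentrated_profile h0 h1
  obtain ⟨K, hK⟩ : ∃ K, ∀ t, |f t| ≤ K := by
    obtain ⟨K, hK⟩ := (isCompact_Icc (a := (0 : ℝ)) (b := 1)).exists_bound_of_continuousOn
      hf.continuous.continuousOn
    refine ⟨K, fun t => ?_⟩
    obtain ⟨y, hy, hfy⟩ := hper.exists_mem_Ico₀ zero_lt_one t
    rw [hfy]; exact hK y ⟨hy.1, hy.2.le⟩
  let φ : (Fin n → ℝ) → Matrix (Fin n) (Fin n) ℝ := fun x => f (∑ a, ξ a * x a) • E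
  have hL : ContDiff ℝ (⊤ : ℕ∞) fun x : Fin n → ℝ => ∑ a, (ξ a : ℝ) * x a := by fun_prop
  have hφ : Admissible φ := by
    refine ⟨fun i j => ?_, fun x k => ?_, fun x => ?_, fun x i => ?_⟩
    · exact (hf.comp hL).mul contDiff_const
    · simp only [φ]
      congr 1
      have : ∑ a, (ξ a : ℝ) * (x + fun i => (k i : ℝ)) a =
          ∑ a, (ξ a : ℝ) * x a + ((∑ a, ξ a * k a : ℤ) : ℝ) * 1 := by
        push_cast
        simp [mul_add, Finset.sum_add_distrib]
      rw [this]
      exact hper.int_mul _ _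
    · ext i j
      simp [φ, E, Matrix.vecMulVec_apply, mul_comm (v i)]
    · have hd : ∀ j, fderiv ℝ (fun y => φ y i j) x (Pi.single j 1) =
          deriv f (∑ a, ξ a * x a) * (v i * (ξ j * v j)) := by
        intro j
        have h2 : HasFDerivAt (fun x : Fin n → ℝ => ∑ a, (ξ a : ℝ) * x a)
            (∑ a, (ξ a : ℝ) • ContinuousLinearMap.proj a : (Fin n → ℝ) →L[ℝ] ℝ) x := by
          refine HasFDerivAt.fun_sum fun a _ => ?_
          exact (ContinuousLinearMap.proj (R := ℝ)
            (φ := fun _ : Fin n => ℝ) a).hasFDerivAt.const_mul _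
        have h3 := ((hf.differentiable_top _).hasDerivAt.comp_hasFDerivAt x h2).mul_const (E i j)
        change fderiv ℝ (fun y => f (∑ a, ξ a * y a) * E i j) x _ = _
        have h4 := h3.fderiv
        simp only [Function.comp_def] at h4
        rw [h4]
        simp [E, Matrix.vecMulVec_apply, Pi.single_apply]
        ring
      simp_rw [hd, ← Finset.mul_sum, hv, mul_zero]
  have hmean : (Matrix.of fun i j => ∫ y in unitCube n, φ y i j) = E := by
    ext a b
    simp only [φ, Matrix.of_apply, Matrix.smul_apply, smul_eq_mul]
    rw [integral_mul_const, setIntegral_unitCube_comp_int_linear hper hf.continuous.measurable hK ξ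
      i hi, hint, one_mul]
  obtain ⟨B, hB, hBφ⟩ := hφ.exists_eq_mean_add_stress
  rw [hmean] at hBφ
  obtain ⟨M, hM1, hM2, hM3⟩ := hB.exists_bounds
  set D := α * (K ^ 2 * frobSq E)
  have hD : 0 ≤ D := by have := frobSq_nonneg E; positivity
  refine ⟨min 1 (ε / 2 / (D + 1)), by positivity, M, fun c hc => ?_⟩
  have hc1 : |c| ≤ 1 := hc.le.trans (min_le_left _ _)
  have hscale : ∀ t, |t| ≤ M → |c * t| ≤ M := fun t ht => by
    rw [abs_mul]; nlinarith [abs_nonneg t, abs_nonneg c]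
  refine ⟨c • B, hB.smul c, fun i k j l x => hscale _ (hM1 i k j l x), fun a i k j l x => ?_,
    fun x i j => ?_, ?_⟩
  · simp only [Pi.smul_apply]
    rw [pd_smul a c (hB.smooth i k j l)]
    exact hscale _ (hM2 a i k j l x)
  · rw [stress_smul c hB.smooth]
    exact hscale _ (hM3 x i j)
  have hDc : D * c ^ 2 ≤ ε / 2 := by
    have h5 : |c| ≤ ε / 2 / (D + 1) := hc.le.trans (min_le_right _ _)
    rw [le_div_iff₀ (by positivity)] at h5
    rw [← sq_abs]
    nlinarith [abs_nonneg c, mul_nonneg hD (abs_nonneg c)]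
  let J : ℝ → ℝ := fun t => if f t = 0 then 0 else β
  have hJm : Measurable J :=
    Measurable.ite (hf.continuous.measurable (measurableSet_singleton 0)) measurable_const
      measurable_const
  have hJ0 : ∀ t, 0 ≤ J t := fun t => by simp only [J]; split_ifs <;> positivity
  have hJK : ∀ t, |J t| ≤ β := fun t => by
    rw [abs_of_nonneg (hJ0 t)]; simp only [J]; split_ifs <;> linarith
  have hJi : ∀ a b, IntervalIntegrable J volume a b := fun a b =>
    (intervalIntegrable_const (c := β)).mono_fun hJm.aestronglyMeasurable
      (Filter.Eventually.of_forall fun t => by simpa [abs_of_pos hβ] using hJK t)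
  have hJint : ∫ t in (0 : ℝ)..1, J t ≤ ε / 2 := by
    rw [← intervalIntegral.integral_add_adjacent_intervals (hJi 0 (θ / 2)) (hJi _ 1),
      ← intervalIntegral.integral_add_adjacent_intervals (hJi (θ / 2) (1 - θ / 2)) (hJi _ 1)]
    have hle : ∀ a b, a ≤ b → ∫ t in a..b, J t ≤ β * (b - a) := fun a b hab => by
      refine (intervalIntegral.integral_mono_on hab (hJi a b) intervalIntegrable_const
        fun t _ => (le_abs_self _).trans (hJK t)).trans_eq ?_
      simp [mul_comm]
    have hz : ∫ t in (θ / 2)..(1 - θ / 2), J t = 0 := by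
      refine (intervalIntegral.integral_congr (g := fun _ => 0) fun t ht => ?_).trans (by simp)
      rw [Set.uIcc_of_le (by linarith)] at ht
      simp [J, hzero t ht]
    have h5 := hle 0 (θ / 2) (by positivity)
    have h6 := hle (1 - θ / 2) 1 (by linarith)
    rw [hz]
    nlinarith
  calc ∫ x in unitCube n, kohnStrang α β (c • E + stress (c • B) x)
      ≤ ∫ x in unitCube n, (D * c ^ 2 + J (∑ a, ξ a * x a)) := by
        refine integral_mono ((hB.smul c).integrableOn_kohnStrang hα hβ _)
          (integrableOn_unitCube (K := D * c ^ 2 + β)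
            (measurable_const.add (hJm.comp (by fun_prop))) fun x => ?_) fun x => ?_
        · exact (abs_add_le _ _).trans (add_le_add (abs_of_nonneg (by positivity)).le (hJK _))
        · simp only
          rw [stress_smul c hB.smooth, ← smul_add, ← hBφ]
          refine (kohnStrang_smul_le hα hβ c _ (hK _) E).trans_eq ?_
          simp only [D, J]
          ring
    _ = D * c ^ 2 + ∫ t in (0 : ℝ)..1, J t := by
        have hJi' : IntegrableOn (fun x : Fin n → ℝ => J (∑ a, ξ a * x a)) (unitCube n) :=
          integrableOn_unitCube (K := β) (hJm.comp (by fun_prop)) fun x => hJK _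
        rw [integral_add continuous_const.integrableOn_unitCube hJi', setIntegral_unitCube_const,
          setIntegral_unitCube_comp_int_linear _ hJm hJK ξ i hi]
        intro t
        simp only [J, hper t]
    _ ≤ ε := by linarith

lemma exists_hasCorrector_sum (hα : 0 < α) (hβ : 0 < β) {ι : Type*} (s : Finset ι)
    (E : ι → Matrix (Fin n) (Fin n) ℝ → Matrix (Fin n) (Fin n) ℝ)
    (h : ∀ a ∈ s, ∀ ε > 0, ∃ δ > 0, ∃ M, ∀ A : Matrix (Fin n) (Fin n) ℝ, (∀ i j, |A i j| < δ) →
      HasCorrector α β M (E a A) ε) : ∀ ε > 0, ∃ δ > 0, ∃ M, ∀ A : Matrix (Fin n) (Fin n) ℝ,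
        (∀ i j, |A i j| < δ) → HasCorrector α β M (∑ a ∈ s, E a A) ε := by
  classical
  induction s using Finset.induction_on with
  | empty =>
    intro ε hε
    obtain ⟨M, h1, h2, h3⟩ := (IsPot.zero (n := n)).exists_bounds
    refine ⟨1, one_pos, M, fun A _ => ⟨0, IsPot.zero, h1, h2, h3, ?_⟩⟩
    simpa [stress_zero, kohnStrang_zero] using hε.le
  | insert a s ha ih =>
    intro ε hε
    obtain ⟨δ1, hδ1, M1, h1⟩ := h a (Finset.mem_insert_self _ _) (ε / 4) (by positivity)
    obtain ⟨δ2, hδ2, M2, h2⟩ := ih (fun b hb => h b (Finset.mem_insert_of_mem hb)) (ε / 4)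
      (by positivity)
    refine ⟨min δ1 δ2, lt_min hδ1 hδ2, M1 + M2, fun A hA => ?_⟩
    rw [Finset.sum_insert ha]
    refine ((h1 A fun i j => (hA i j).trans_le (min_le_left _ _)).add hα hβ one_pos
      (h2 A fun i j => (hA i j).trans_le (min_le_right _ _))).mono le_rfl ?_
    norm_num
    linarith

/-- Symmetric matrices close to zero admit uniformly bounded correctors with small energy. -/
lemma exists_hasCorrector_of_small (hn : 2 ≤ n) (hα : 0 < α) (hβ : 0 < β) {ε : ℝ} (hε : 0 < ε) :
    ∃ δ > 0, ∃ M, ∀ A : Matrix (Fin n) (Fin n) ℝ, A.IsSymm → (∀ i j, |A i j| < δ) →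
      HasCorrector α β M A ε := by
  have key : ∀ (i j : Fin n) (r : ℝ) (_ : |r| ≤ 1) (v : Fin n → ℝ) (ξ : Fin n → ℤ) (k : Fin n)
      (_ : ξ k = 1) (_ : ∑ a, ξ a * v a = 0), ∀ ε > 0, ∃ δ > 0, ∃ M,
      ∀ A : Matrix (Fin n) (Fin n) ℝ, (∀ i j, |A i j| < δ) →
        HasCorrector α β M ((r * A i j) • Matrix.vecMulVec v v) ε := by
    intro i j r hr v ξ k hk hv ε hε
    obtain ⟨δ, hδ, M, h⟩ := exists_hasCorrector_smul_vecMulVec hα hβ v ξ k hk hv hε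
    refine ⟨δ, hδ, M, fun A hA => h _ ?_⟩
    rw [abs_mul]
    exact (mul_le_of_le_one_left (abs_nonneg _) hr).trans_lt (hA i j)
  have hex : ∀ i : Fin n, ∃ k, k ≠ i := fun i => by
    have : Nontrivial (Fin n) := Fin.nontrivial_iff_two_le.2 hn
    exact exists_ne i
  let e : Fin n → Fin n → ℝ := fun i => Pi.single i 1
  have hdir : ∀ i j : Fin n, ∃ (ξ : Fin n → ℤ) (k : Fin n), ξ k = 1 ∧
      ∑ a, ξ a * (e i + e j) a = 0 := by
    intro i j
    by_cases hij : i = j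
    · subst hij
      obtain ⟨k, hk⟩ := hex i
      refine ⟨Pi.single k 1, k, by simp, ?_⟩
      rw [Finset.sum_eq_single k (fun a _ ha => by simp [ha]) (by simp)]
      simp [e, hk]
    · refine ⟨Pi.single i 1 - Pi.single j 1, i, by simp [hij], ?_⟩
      simp [e, Pi.single_apply, mul_add, Finset.sum_add_distrib, hij, Ne.symm hij]
  have hdir' : ∀ i : Fin n, ∃ (ξ : Fin n → ℤ) (k : Fin n), ξ k = 1 ∧ ∑ a, ξ a * e i a = 0 := by
    intro i
    obtain ⟨k, hk⟩ := hex i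
    refine ⟨Pi.single k 1, k, by simp, ?_⟩
    rw [Finset.sum_eq_single k (fun a _ ha => by simp [ha]) (by simp)]
    simp [e, hk]
  let E : Fin 3 → Fin n → Fin n → Matrix (Fin n) (Fin n) ℝ → Matrix (Fin n) (Fin n) ℝ :=
    ![fun i j A => ((1 / 2) * A i j) • Matrix.vecMulVec (e i + e j) (e i + e j),
      fun i j A => ((-1 / 2) * A i j) • Matrix.vecMulVec (e i) (e i),
      fun i j A => ((-1 / 2) * A i j) • Matrix.vecMulVec (e j) (e j)]
  obtain ⟨δ, hδ, M, h⟩ := exists_hasCorrector_sum (α := α) (β := β) hα hβ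
    (Finset.univ : Finset (Fin n × Fin n × Fin 3)) (fun p => E p.2.2 p.1 p.2.1) (by
      rintro ⟨i, j, t⟩ -
      obtain ⟨ξ, k, hk, hv⟩ := hdir i j
      obtain ⟨ξ', k', hk', hv'⟩ := hdir' i
      obtain ⟨ξ'', k'', hk'', hv''⟩ := hdir' j
      fin_cases t
      · exact key i j (1 / 2) (by norm_num) _ ξ k hk hv
      · exact key i j (-1 / 2) (by norm_num [abs_le]) _ ξ' k' hk' hv'
      · exact key i j (-1 / 2) (by norm_num [abs_le]) _ ξ'' k'' hk'' hv'') ε hε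
  refine ⟨δ, hδ, M, fun A hA hAδ => ?_⟩
  have hdec : ∑ p : Fin n × Fin n × Fin 3, E p.2.2 p.1 p.2.1 A = A := by
    simp only [Fintype.sum_prod_type, Fin.sum_univ_three]
    have h1 : ∀ i j, E 0 i j A + E 1 i j A + E 2 i j A =
        ((1 / 2) * A i j) • (Matrix.single i j 1 + Matrix.single j i 1) := by
      intro i j
      have : ∀ u w : Fin n, Matrix.vecMulVec (e u) (e w) = Matrix.single u w 1 := fun u w => by
        simp [e, Matrix.single_eq_single_vecMulVec_single]
      change ((1 / 2) * A i j) • Matrix.vecMulVec (e i + e j) (e i + e j) +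
        ((-1 / 2) * A i j) • Matrix.vecMulVec (e i) (e i) +
        ((-1 / 2) * A i j) • Matrix.vecMulVec (e j) (e j) = _
      simp only [Matrix.add_vecMulVec, Matrix.vecMulVec_add, this]
      module
    simp_rw [h1]
    have h2 : ∑ i, ∑ j, ((1 / 2) * A i j) • Matrix.single i j (1 : ℝ) = (1 / 2 : ℝ) • A := by
      conv_rhs => rw [Matrix.matrix_eq_sum_single A]
      simp [Finset.smul_sum, Matrix.smul_single]
    have h3 : ∑ i, ∑ j, ((1 / 2) * A i j) • Matrix.single j i (1 : ℝ) = (1 / 2 : ℝ) • A := by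
      rw [Finset.sum_comm, ← h2]
      exact Finset.sum_congr rfl fun i _ => Finset.sum_congr rfl fun j _ => by rw [hA.apply]
    simp_rw [smul_add, Finset.sum_add_distrib, h2, h3]
    module
  rw [← hdec]
  exact h A hAδ

end lamination

section uniformity

variable {n : ℕ} {α β : ℝ}

lemma SmoothPer.exists_lipschitz {f : (Fin n → ℝ) → ℝ} (hf : SmoothPer f) :
    ∃ L, 0 ≤ L ∧ ∀ x y, |f x - f y| ≤ L * ‖x - y‖ := by
  obtain ⟨K, hK0, hK⟩ := exists_common_bound fun k => hf.pd k
  refine ⟨n * K, by positivity, fun x y => ?_⟩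
  exact convex_univ.norm_image_sub_le_of_norm_fderiv_le (fun z _ => hf.smooth.differentiable_top z)
    (fun z _ => norm_fderiv_le_of_pd fun k => hK k z) (Set.mem_univ y) (Set.mem_univ x)

lemma exists_common_lipschitz {ι : Type*} [Fintype ι] {F : ι → (Fin n → ℝ) → ℝ}
    (hF : ∀ a, SmoothPer (F a)) : ∃ L, 0 ≤ L ∧ ∀ a x y, |F a x - F a y| ≤ L * ‖x - y‖ := by
  choose L hL0 hL using fun a => (hF a).exists_lipschitz
  refine ⟨∑ a, L a, Finset.sum_nonneg fun a _ => hL0 a, fun a x y => (hL a x y).trans ?_⟩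
  gcongr
  exact Finset.single_le_sum (f := L) (fun a _ => hL0 a) (Finset.mem_univ a)

lemma exists_weights {H ε : ℝ} (hH : 0 ≤ H) (hε : 0 < ε) :
    ∃ δ > 0, ∃ ε' > 0, δ * H ≤ ε / 2 ∧ (1 + δ⁻¹) * ε' ≤ ε / 2 := by
  have hδ : 0 < ε / 2 / (H + 1) := by positivity
  have hδ' := inv_pos.2 hδ
  refine ⟨ε / 2 / (H + 1), hδ, ε / 2 / (1 + (ε / 2 / (H + 1))⁻¹), by positivity, ?_, ?_⟩
  · rw [div_mul_eq_mul_div, div_le_iff₀ (by positivity)]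
    nlinarith
  · rw [mul_div_cancel₀ _ (by positivity)]

lemma exists_QdivKohnStrang_le_add (hn : 2 ≤ n) (hα : 0 < α) (hβ : 0 < β) {H ε : ℝ} (hH : 0 ≤ H)
    (hε : 0 < ε) : ∃ δ > 0, ∀ A A' : Matrix (Fin n) (Fin n) ℝ, A.IsSymm → A'.IsSymm →
      QdivKohnStrang n α β A ≤ H → (∀ i j, |A' i j - A i j| < δ) →
      QdivKohnStrang n α β A' ≤ QdivKohnStrang n α β A + ε := by
  obtain ⟨η, hη, ε', hε', h1, h2⟩ := exists_weights hH hε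
  obtain ⟨δ, hδ, M, h⟩ := exists_hasCorrector_of_small hn hα hβ hε'
  refine ⟨δ, hδ, fun A A' hA hA' hAH hd => ?_⟩
  have hD : (A' - A).IsSymm := hA'.sub hA
  have h3 := QdivKohnStrang_le_of_hasCorrector hα hβ hD (h _ hD hd)
  have h4 := QdivKohnStrang_add_le hα hβ hη hA hD
  have hη' := inv_pos.2 hη
  rw [add_sub_cancel] at h4
  have h5 : (1 + η⁻¹) * QdivKohnStrang n α β (A' - A) ≤ (1 + η⁻¹) * ε' := by gcongr
  have h6 : η * QdivKohnStrang n α β A ≤ η * H := by gcongr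
  linarith

lemma exists_hasCorrector_of_near (hn : 2 ≤ n) (hα : 0 < α) (hβ : 0 < β) {H ε : ℝ} (hH : 0 ≤ H)
    (hε : 0 < ε) : ∃ δ > 0, ∀ A : Matrix (Fin n) (Fin n) ℝ, A.IsSymm →
      QdivKohnStrang n α β A ≤ H → ∃ M, ∀ A' : Matrix (Fin n) (Fin n) ℝ, A'.IsSymm →
      (∀ i j, |A' i j - A i j| < δ) → HasCorrector α β M A' (QdivKohnStrang n α β A + ε) := by
  obtain ⟨η, hη, ε', hε', h1, h2⟩ := exists_weights (H := H + ε) (by positivity) (half_pos hε)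
  obtain ⟨δ, hδ, M', h⟩ := exists_hasCorrector_of_small hn hα hβ hε'
  refine ⟨δ, hδ, fun A hA hAH => ?_⟩
  obtain ⟨M, hM⟩ := exists_hasCorrector (α := α) (β := β) hA (half_pos hε)
  refine ⟨M + M', fun A' hA' hd => ?_⟩
  have h3 := hM.add hα hβ hη (h (A' - A) (hA'.sub hA) hd)
  rw [add_sub_cancel] at h3
  refine h3.mono le_rfl ?_
  have h6 : η * (QdivKohnStrang n α β A + ε / 2) ≤ η * (H + ε) := by gcongr; linarith
  linarith

namespace Admissible

variable {ψ : (Fin n → ℝ) → Matrix (Fin n) (Fin n) ℝ}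

lemma smoothPer (hψ : Admissible ψ) (i j : Fin n) : SmoothPer fun x => ψ x i j :=
  ⟨hψ.1 i j, fun x k => by rw [hψ.2.1 x k]⟩

lemma exists_bound (hψ : Admissible ψ) : ∃ K, 0 ≤ K ∧ ∀ x i j, |ψ x i j| ≤ K := by
  obtain ⟨K, h0, hK⟩ := exists_common_bound (F := fun (p : Fin n × Fin n) x => ψ x p.1 p.2)
    fun p => hψ.smoothPer p.1 p.2
  exact ⟨K, h0, fun x i j => hK (i, j) x⟩

lemma exists_near (hψ : Admissible ψ) {δ : ℝ} (hδ : 0 < δ) :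
    ∃ ρ > 0, ∀ x y, ‖x - y‖ < ρ → ∀ i j, |ψ x i j - ψ y i j| < δ := by
  obtain ⟨L, h0, hL⟩ := exists_common_lipschitz (F := fun (p : Fin n × Fin n) x => ψ x p.1 p.2)
    fun p => hψ.smoothPer p.1 p.2
  refine ⟨δ / (L + 1), by positivity, fun x y h i j => (hL (i, j) x y).trans_lt ?_⟩
  rw [lt_div_iff₀ (by positivity)] at h
  nlinarith [norm_nonneg (x - y)]

lemma exists_QdivKohnStrang_bound (hα : 0 < α) (hβ : 0 < β) (hψ : Admissible ψ) :
    ∃ H, 0 ≤ H ∧ ∀ x, QdivKohnStrang n α β (ψ x) ≤ H := by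
  obtain ⟨K, h0, hK⟩ := hψ.exists_bound
  exact ⟨α * (n ^ 2 * K ^ 2) + β, by positivity, fun x =>
    (QdivKohnStrang_le_kohnStrang hα hβ (hψ.2.2.1 x)).trans
      (kohnStrang_le_of_abs_le hα hβ (hK x))⟩

lemma uniformity (hn : 2 ≤ n) (hα : 0 < α) (hβ : 0 < β) (hψ : Admissible ψ) {ε : ℝ} (hε : 0 < ε) :
    ∃ ρ > 0, ∀ x y, ‖x - y‖ < ρ →
      QdivKohnStrang n α β (ψ x) ≤ QdivKohnStrang n α β (ψ y) + ε := by
  obtain ⟨H, hH0, hH⟩ := hψ.exists_QdivKohnStrang_bound hα hβ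
  obtain ⟨δ, hδ, h⟩ := exists_QdivKohnStrang_le_add hn hα hβ hH0 hε
  obtain ⟨ρ, hρ, h'⟩ := hψ.exists_near hδ
  exact ⟨ρ, hρ, fun x y hxy => h _ _ (hψ.2.2.1 y) (hψ.2.2.1 x) (hH y) (h' x y hxy)⟩

lemma continuous_QdivKohnStrang (hn : 2 ≤ n) (hα : 0 < α) (hβ : 0 < β) (hψ : Admissible ψ) :
    Continuous fun x => QdivKohnStrang n α β (ψ x) := by
  rw [Metric.continuous_iff]
  intro y ε hε
  obtain ⟨ρ, hρ, h⟩ := hψ.uniformity hn hα hβ (half_pos hε)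
  refine ⟨ρ, hρ, fun x hx => ?_⟩
  rw [dist_eq_norm] at hx
  have h1 := h x y hx
  have h2 := h y x (by rwa [norm_sub_rev])
  rw [Real.dist_eq, abs_lt]
  constructor <;> linarith

lemma exists_hasCorrector (hn : 2 ≤ n) (hα : 0 < α) (hβ : 0 < β) (hψ : Admissible ψ) {ε : ℝ}
    (hε : 0 < ε) : ∃ M, ∀ x, HasCorrector α β M (ψ x) (QdivKohnStrang n α β (ψ x) + ε) := by
  obtain ⟨H, hH0, hH⟩ := hψ.exists_QdivKohnStrang_bound hα hβ
  obtain ⟨δ, hδ, h⟩ := exists_hasCorrector_of_near (H := H) hn hα hβ hH0 (half_pos hε)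
  obtain ⟨ρ, hρ, hnear⟩ := hψ.exists_near hδ
  obtain ⟨ρ', hρ', hunif⟩ := hψ.uniformity hn hα hβ (half_pos hε)
  have hc : ∃ M, ∀ x ∈ Set.Icc (0 : Fin n → ℝ) 1,
      HasCorrector α β M (ψ x) (QdivKohnStrang n α β (ψ x) + ε) := by
    refine isCompact_Icc.induction_on (p := fun s => ∃ M, ∀ x ∈ s,
      HasCorrector α β M (ψ x) (QdivKohnStrang n α β (ψ x) + ε)) ⟨0, by simp⟩ ?_ ?_ ?_
    · rintro s t hst ⟨M, hM⟩
      exact ⟨M, fun x hx => hM x (hst hx)⟩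
    · rintro s t ⟨M, hM⟩ ⟨M', hM'⟩
      refine ⟨max M M', fun x hx => hx.elim (fun hx => (hM x hx).mono (le_max_left _ _) le_rfl)
        fun hx => (hM' x hx).mono (le_max_right _ _) le_rfl⟩
    · intro x _
      obtain ⟨M, hM⟩ := h (ψ x) (hψ.2.2.1 x) (hH x)
      refine ⟨Metric.ball x (min ρ ρ'),
        mem_nhdsWithin_of_mem_nhds (Metric.ball_mem_nhds x (lt_min hρ hρ')), M, fun y hy => ?_⟩
      rw [mem_ball_iff_norm, lt_min_iff] at hy
      refine (hM (ψ y) (hψ.2.2.1 y) (hnear y x hy.1)).mono le_rfl ?_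
      have := hunif x y (by rw [norm_sub_rev]; exact hy.2)
      linarith
  obtain ⟨M, hM⟩ := hc
  refine ⟨M, fun x => ?_⟩
  obtain ⟨y, hy, k, rfl⟩ := SmoothPer.exists_mem_Icc x
  rw [hψ.2.1 y k]
  exact hM y hy

end Admissible

end uniformity

section localization

variable {n : ℕ}

lemma pd_apply_eq_zero_of_eqOn_compl {f : (Fin n → ℝ) → ℝ} {K : Set (Fin n → ℝ)} (hK : IsClosed K)
    (h : ∀ x ∉ K, f x = 0) (k : Fin n) : ∀ x ∉ K, pd k f x = 0 := by
  intro x hx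
  have : f =ᶠ[nhds x] 0 := Filter.mem_of_superset (hK.isOpen_compl.mem_nhds hx) h
  rw [(pd_congr_of_eventuallyEq k this).eq_of_nhds, pd_zero, Pi.zero_apply]

lemma exists_bound_of_eqOn_compl {ι : Type*} [Fintype ι] {F : ι → (Fin n → ℝ) → ℝ}
    {K : Set (Fin n → ℝ)} (hK : IsCompact K) (hF : ∀ a, Continuous (F a))
    (h : ∀ a, ∀ x ∉ K, F a x = 0) : ∃ L, 0 ≤ L ∧ ∀ a x, |F a x| ≤ L := by
  choose L hL using fun a => hK.exists_bound_of_continuousOn (hF a).continuousOn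
  refine ⟨∑ a, |L a|, by positivity, fun a x => ?_⟩
  refine le_trans ?_ (Finset.single_le_sum (f := fun a => |L a|) (fun a _ => abs_nonneg _)
    (Finset.mem_univ a))
  by_cases hx : x ∈ K
  · exact (hL a x hx).trans (le_abs_self _)
  · rw [h a x hx, abs_zero]; exact abs_nonneg _

/-- Smooth cutoff functions supported in the unit cube which equal one on most of the cube. -/
lemma exists_cutoff (n : ℕ) {κ : ℝ} (hκ : 0 < κ) :
    ∃ (η : (Fin n → ℝ) → ℝ) (r : ℝ) (S : Set (Fin n → ℝ)) (L : ℝ),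
    ContDiff ℝ (⊤ : ℕ∞) η ∧ (∀ x, |η x| ≤ 1) ∧ 0 < r ∧
    (∀ x i, x i ∉ Set.Icc r (1 - r) → η x = 0) ∧
    IsOpen S ∧ S ⊆ unitCube n ∧ (∀ x ∈ S, η x = 1) ∧ volume.real (unitCube n \ S) ≤ κ ∧
    0 ≤ L ∧ (∀ k x, |pd k η x| ≤ L) ∧ ∀ k l x, |pd k (pd l η) x| ≤ L := by
  obtain ⟨r, hr0, hr1, hr2⟩ : ∃ r : ℝ, 0 < r ∧ r ≤ 1 / 16 ∧ n * (4 * r) ≤ κ := by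
    refine ⟨min (1 / 16) (κ / (4 * (n + 1))), by positivity, min_le_left _ _, ?_⟩
    have := min_le_right (1 / 16) (κ / (4 * ((n : ℝ) + 1)))
    rw [le_div_iff₀ (by positivity)] at this
    have h0 : 0 ≤ min (1 / 16) (κ / (4 * ((n : ℝ) + 1))) := by positivity
    nlinarith
  let c : Fin n → ℝ := fun _ => 1 / 2
  let η : ContDiffBump c := ⟨1 / 2 - 2 * r, 1 / 2 - r, by linarith, by linarith⟩
  have hη : ContDiff ℝ (⊤ : ℕ∞) η := η.contDiff
  have hz : ∀ x i, x i ∉ Set.Icc r (1 - r) → η x = 0 := by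
    intro x i hx
    refine η.zero_of_le_dist (le_trans ?_ (dist_le_pi_dist x c i))
    change 1 / 2 - r ≤ _
    rw [Real.dist_eq]
    by_contra! hlt
    rw [abs_lt] at hlt
    exact hx ⟨by linarith, by linarith⟩
  have hK : ∀ x ∉ Set.Icc (0 : Fin n → ℝ) 1, η x = 0 := by
    intro x hx
    by_contra hne
    refine hx ⟨fun i => ?_, fun i => ?_⟩ <;>
    · have := not_imp_comm.1 (hz x i) hne
      simp only [Pi.zero_apply, Pi.one_apply]
      linarith [this.1, this.2]
  obtain ⟨L1, hL1, h1⟩ := exists_bound_of_eqOn_compl (F := fun k => pd k η) isCompact_Icc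
    (fun k => (hη.pd k).continuous) fun k => pd_apply_eq_zero_of_eqOn_compl isClosed_Icc hK k
  obtain ⟨L2, hL2, h2⟩ := exists_bound_of_eqOn_compl
    (F := fun p : Fin n × Fin n => pd p.1 (pd p.2 η)) isCompact_Icc
    (fun p => ((hη.pd p.2).pd p.1).continuous) fun p =>
      pd_apply_eq_zero_of_eqOn_compl isClosed_Icc
        (pd_apply_eq_zero_of_eqOn_compl isClosed_Icc hK p.2) p.1
  have hS : Metric.ball c (1 / 2 - 2 * r) ⊆ unitCube n := by
    intro x hx i _
    have := (dist_le_pi_dist x c i).trans_lt hx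
    rw [Real.dist_eq, abs_lt] at this
    constructor <;> linarith [this.1, this.2]
  refine ⟨η, r, Metric.ball c (1 / 2 - 2 * r), max L1 L2, hη, fun x => ?_, hr0, hz,
    Metric.isOpen_ball, hS, fun x hx => ?_, ?_, le_max_of_le_left hL1,
    fun k x => (h1 k x).trans (le_max_left _ _),
    fun k l x => (h2 (k, l) x).trans (le_max_right _ _)⟩
  · rw [abs_of_nonneg η.nonneg]; exact η.le_one
  · exact η.one_of_mem_closedBall (Metric.ball_subset_closedBall hx)
  · rw [measureReal_sdiff hS Metric.isOpen_ball.measurableSet (by simp [volume_unitCube]),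
      volume_real_unitCube, Measure.real, Real.volume_pi_ball _ (by linarith),
      ENNReal.toReal_ofReal (by apply pow_nonneg; linarith), Fintype.card_fin]
    have := one_add_mul_le_pow (a := -(4 * r)) (by linarith) n
    rw [show 2 * (1 / 2 - 2 * r) = 1 + -(4 * r) by ring]
    linarith

lemma pd_coord (a k : Fin n) :
    pd a (fun y : Fin n → ℝ => y k) = fun _ => if a = k then (1 : ℝ) else 0 := by
  ext y
  have h : HasFDerivAt (fun y : Fin n → ℝ => y k)
      (ContinuousLinearMap.proj (R := ℝ) (φ := fun _ : Fin n => ℝ) k) y :=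
    (ContinuousLinearMap.proj (R := ℝ) (φ := fun _ : Fin n => ℝ) k).hasFDerivAt
  simp [pd, h.fderiv, Pi.single_apply, eq_comm]

/-- The second order Taylor remainder at the origin. -/
noncomputable def taylorRem (g : (Fin n → ℝ) → ℝ) (y : Fin n → ℝ) : ℝ :=
  g y - g 0 - ∑ k, pd k g 0 * y k - 1 / 2 * ∑ k, ∑ l, pd k (pd l g) 0 * (y k * y l)

variable {g : (Fin n → ℝ) → ℝ}

lemma taylorRem_neg : taylorRem (-g) = -taylorRem g := by
  ext y
  simp only [taylorRem, pd_neg, Pi.neg_apply, neg_mul, Finset.sum_neg_distrib]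
  ring

lemma taylorRem_zero : taylorRem g 0 = 0 := by simp [taylorRem]

lemma contDiff_taylorRem (hg : ContDiff ℝ (⊤ : ℕ∞) g) : ContDiff ℝ (⊤ : ℕ∞) (taylorRem g) := by
  unfold taylorRem
  fun_prop

lemma pd_taylorRem (hg : ContDiff ℝ (⊤ : ℕ∞) g) (a : Fin n) :
    pd a (taylorRem g) = fun y => pd a g y - pd a g 0 - ∑ l, pd a (pd l g) 0 * y l := by
  have hX : ∀ k, ContDiff ℝ (⊤ : ℕ∞) fun y : Fin n → ℝ => y k := fun k => by fun_prop
  have hXX : ∀ k l (c : ℝ), ContDiff ℝ (⊤ : ℕ∞)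
      (c • ((fun y : Fin n → ℝ => y k) * fun y => y l)) := fun k l c =>
    contDiff_const.smul ((hX k).mul (hX l))
  have e : taylorRem g = g - (fun _ => g 0) - ∑ k, (pd k g 0 • fun y : Fin n → ℝ => y k) -
      ∑ k, ∑ l, (1 / 2 * pd k (pd l g) 0) • ((fun y : Fin n → ℝ => y k) * fun y => y l) := by
    ext y
    simp [taylorRem, Finset.mul_sum, mul_assoc]
  have h1 : ContDiff ℝ (⊤ : ℕ∞) (∑ k, (pd k g 0 • fun y : Fin n → ℝ => y k)) := by
    rw [show (∑ k, (pd k g 0 • fun y : Fin n → ℝ => y k)) = fun y => ∑ k, pd k g 0 * y k by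
      ext; simp]
    fun_prop
  have h2 : ∀ k, ContDiff ℝ (⊤ : ℕ∞)
      (∑ l, (1 / 2 * pd k (pd l g) 0) • ((fun y : Fin n → ℝ => y k) * fun y => y l)) := fun k => by
    rw [show (∑ l, (1 / 2 * pd k (pd l g) 0) • ((fun y : Fin n → ℝ => y k) * fun y => y l)) =
      fun y => ∑ l, (1 / 2 * pd k (pd l g) 0) * (y k * y l) by ext; simp]
    fun_prop
  have h3 : ContDiff ℝ (⊤ : ℕ∞) (∑ k, ∑ l, (1 / 2 * pd k (pd l g) 0) •
      ((fun y : Fin n → ℝ => y k) * fun y => y l)) := by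
    rw [show (∑ k, ∑ l, (1 / 2 * pd k (pd l g) 0) • ((fun y : Fin n → ℝ => y k) * fun y => y l)) =
      fun y => ∑ k, ∑ l, (1 / 2 * pd k (pd l g) 0) * (y k * y l) by ext; simp]
    fun_prop
  have hcX : ∀ (k : Fin n) (c : ℝ), ContDiff ℝ (⊤ : ℕ∞) (c • fun y : Fin n → ℝ => y k) :=
    fun k c => contDiff_const.smul (hX k)
  have h4 : ContDiff ℝ (⊤ : ℕ∞) (g - fun _ => g 0) := hg.sub contDiff_const
  have h5 : ContDiff ℝ (⊤ : ℕ∞) ((g - fun _ => g 0) - ∑ k, (pd k g 0 • fun y : Fin n → ℝ => y k)) :=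
    h4.sub h1
  rw [e, pd_sub a h5 h3, pd_sub a h4 h1, pd_sub a hg contDiff_const, pd_const,
    pd_sum _ _ fun k => hcX k _, pd_sum _ _ h2]
  have hq : ∀ k l (c : ℝ), pd a (c • ((fun y : Fin n → ℝ => y k) * fun y => y l)) =
      c • ((fun y : Fin n → ℝ => y k) * (fun _ => if a = l then (1 : ℝ) else 0) +
        (fun _ => if a = k then (1 : ℝ) else 0) * fun y => y l) := fun k l c => by
    have hm : ContDiff ℝ (⊤ : ℕ∞) ((fun y : Fin n → ℝ => y k) * fun y => y l) :=
      (hX k).mul (hX l)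
    rw [pd_smul a c hm, pd_mul a (hX k) (hX l), pd_coord, pd_coord]
  simp_rw [pd_sum _ a fun l => hXX _ l _, hq, pd_smul a _ (hX _), pd_coord]
  ext y
  simp only [Pi.sub_apply, Finset.sum_apply, Pi.smul_apply, Pi.add_apply,
    Pi.mul_apply, smul_eq_mul, mul_ite, mul_one, mul_zero, ite_mul, one_mul, zero_mul,
    Finset.sum_ite_eq, Finset.mem_univ, if_true, mul_add, Finset.sum_add_distrib, sub_zero]
  rw [Finset.sum_comm (f := fun k l => if a = k then 1 / 2 * pd k (pd l g) 0 * y l else 0)]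
  simp only [Finset.sum_ite_eq, Finset.mem_univ, if_true]
  simp_rw [pd_comm _ a hg, ← Finset.sum_add_distrib]
  congr 1
  exact Finset.sum_congr rfl fun l _ => by ring

lemma pd_pd_taylorRem (hg : ContDiff ℝ (⊤ : ℕ∞) g) (a b : Fin n) :
    pd b (pd a (taylorRem g)) = fun y => pd b (pd a g) y - pd b (pd a g) 0 := by
  have hX : ∀ k, ContDiff ℝ (⊤ : ℕ∞) fun y : Fin n → ℝ => y k := fun k => by fun_prop
  have e : pd a (taylorRem g) = pd a g - (fun _ => pd a g 0) -
      ∑ l, (pd a (pd l g) 0 • fun y : Fin n → ℝ => y l) := by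
    rw [pd_taylorRem hg]
    ext y
    simp
  have h1 : ContDiff ℝ (⊤ : ℕ∞) (∑ l, (pd a (pd l g) 0 • fun y : Fin n → ℝ => y l)) := by
    rw [show (∑ l, (pd a (pd l g) 0 • fun y : Fin n → ℝ => y l)) =
      fun y => ∑ l, pd a (pd l g) 0 * y l by ext; simp]
    fun_prop
  have hcX : ∀ (k : Fin n) (c : ℝ), ContDiff ℝ (⊤ : ℕ∞) (c • fun y : Fin n → ℝ => y k) :=
    fun k c => contDiff_const.smul (hX k)
  have h4 : ContDiff ℝ (⊤ : ℕ∞) (pd a g - fun _ => pd a g 0) := (hg.pd a).sub contDiff_const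
  rw [e, pd_sub b h4 h1, pd_sub b (hg.pd a) contDiff_const, pd_const,
    pd_sum _ _ fun k => hcX k _]
  simp_rw [pd_smul b _ (hX _), pd_coord]
  ext y
  simp [pd_comm b a hg]

lemma abs_pd_taylorRem_le (hg : ContDiff ℝ (⊤ : ℕ∞) g) {ω : ℝ}
    (h : ∀ a b, ∀ y ∈ Set.Icc (0 : Fin n → ℝ) 1, |pd b (pd a g) y - pd b (pd a g) 0| ≤ ω)
    (a : Fin n) {y : Fin n → ℝ} (hy : y ∈ Set.Icc (0 : Fin n → ℝ) 1) :
    |pd a (taylorRem g) y| ≤ n * ω := by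
  refine abs_le_of_abs_pd_le_of_zero ((contDiff_taylorRem hg).pd a) ?_ (fun b z hz => ?_) hy
  · simp [pd_taylorRem hg]
  · rw [pd_pd_taylorRem hg]; exact h a b z hz

lemma abs_taylorRem_le (hg : ContDiff ℝ (⊤ : ℕ∞) g) {ω : ℝ}
    (h : ∀ a b, ∀ y ∈ Set.Icc (0 : Fin n → ℝ) 1, |pd b (pd a g) y - pd b (pd a g) 0| ≤ ω)
    {y : Fin n → ℝ} (hy : y ∈ Set.Icc (0 : Fin n → ℝ) 1) :
    |taylorRem g y| ≤ n * (n * ω) :=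
  abs_le_of_abs_pd_le_of_zero (contDiff_taylorRem hg) taylorRem_zero
    (fun a _ hz => abs_pd_taylorRem_le hg h a hz) hy

/-- The function equal to `V c` on the unit cell with lower corner `c`. -/
noncomputable def glue (V : (Fin n → ℤ) → (Fin n → ℝ) → ℝ) (y : Fin n → ℝ) : ℝ :=
  V (fun i => ⌊y i⌋) fun i => Int.fract (y i)

lemma isOpen_unitCube : IsOpen (unitCube n) :=
  isOpen_set_pi Set.finite_univ fun _ _ => isOpen_Ioo

lemma glue_int_add (V : (Fin n → ℤ) → (Fin n → ℝ) → ℝ) (c : Fin n → ℤ) {y : Fin n → ℝ}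
    (hy : y ∈ unitCube n) : glue V ((fun i => (c i : ℝ)) + y) = V c y := by
  have h : ∀ i, ⌊(c i : ℝ) + y i⌋ = c i := fun i => by
    rw [Int.floor_intCast_add, Int.floor_eq_zero_iff.2 ⟨(hy i trivial).1.le, (hy i trivial).2⟩,
      add_zero]
  simp [glue, Int.fract, h]

lemma glue_eventuallyEq (V : (Fin n → ℤ) → (Fin n → ℝ) → ℝ) (c : Fin n → ℤ) {y : Fin n → ℝ}
    (hy : y - (fun i => (c i : ℝ)) ∈ unitCube n) :
    glue V =ᶠ[nhds y] fun z => V c (z - fun i => (c i : ℝ)) := by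
  have ho : IsOpen {z : Fin n → ℝ | z - (fun i => (c i : ℝ)) ∈ unitCube n} :=
    isOpen_unitCube.preimage (continuous_id.sub continuous_const)
  refine Filter.mem_of_superset (ho.mem_nhds hy) fun z hz => ?_
  have := glue_int_add V c hz
  rwa [add_sub_cancel] at this

lemma contDiff_glue {V : (Fin n → ℤ) → (Fin n → ℝ) → ℝ} (hV : ∀ c, ContDiff ℝ (⊤ : ℕ∞) (V c))
    {r : ℝ} (hr : 0 < r) (h0 : ∀ c y i, y i ∉ Set.Icc r (1 - r) → V c y = 0) :
    ContDiff ℝ (⊤ : ℕ∞) (glue V) := by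
  rw [contDiff_iff_contDiffAt]
  intro y
  by_cases h : ∃ i, Int.fract (y i) = 0
  · obtain ⟨i, hi⟩ := h
    have ho : ∀ᶠ z in nhds y, |z i - y i| < r := by
      have : Continuous fun z : Fin n → ℝ => |z i - y i| := by fun_prop
      exact this.continuousAt.eventually_lt continuousAt_const (by simpa using hr)
    refine (contDiffAt_const (c := (0 : ℝ))).congr_of_eventuallyEq ?_
    filter_upwards [ho] with z hz
    refine h0 _ _ i fun hmem => ?_
    have h1 : (⌊y i⌋ : ℝ) = y i := by
      have := Int.self_sub_fract (y i)
      rw [hi, sub_zero] at this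
      exact this.symm
    have h2 := Int.floor_add_fract (z i)
    have h3 : (⌊z i⌋ : ℝ) < ⌊y i⌋ := by
      rw [h1]
      linarith [hmem.1, (abs_lt.1 hz).2]
    have h4 : (⌊z i⌋ : ℝ) + 1 ≤ ⌊y i⌋ := by exact_mod_cast h3
    linarith [hmem.2, (abs_lt.1 hz).1]
  · push Not at h
    have hy : y - (fun i => ((⌊y i⌋ : ℤ) : ℝ)) ∈ unitCube n := fun i _ =>
      ⟨lt_of_le_of_ne (Int.fract_nonneg _) (Ne.symm (h i)), Int.fract_lt_one _⟩
    refine ContDiffAt.congr_of_eventuallyEq ?_ (glue_eventuallyEq V (fun i => ⌊y i⌋) hy)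
    exact ((hV _).comp (contDiff_id.sub contDiff_const)).contDiffAt

end localization

section cells

variable {n : ℕ} {B C G : Fin n → Fin n → Fin n → Fin n → (Fin n → ℝ) → ℝ}

lemma pd_pd_mul {f g : (Fin n → ℝ) → ℝ} (k l : Fin n) (hf : ContDiff ℝ (⊤ : ℕ∞) f)
    (hg : ContDiff ℝ (⊤ : ℕ∞) g) : pd k (pd l (f * g)) =
      f * pd k (pd l g) + (pd k f * pd l g + pd l f * pd k g + pd k (pd l f) * g) := by
  have h1 : ContDiff ℝ (⊤ : ℕ∞) (f * pd l g) := hf.mul (hg.pd l)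
  have h2 : ContDiff ℝ (⊤ : ℕ∞) (pd l f * g) := (hf.pd l).mul hg
  rw [pd_mul l hf hg, pd_add k h1 h2, pd_mul k hf (hg.pd l), pd_mul k (hf.pd l) hg]
  ring

lemma abs_stress_mul_le {η : (Fin n → ℝ) → ℝ} (hη : ContDiff ℝ (⊤ : ℕ∞) η)
    (hG : ∀ i k j l, ContDiff ℝ (⊤ : ℕ∞) (G i k j l)) {x : Fin n → ℝ} {L t : ℝ} (hL0 : 0 ≤ L)
    (h1 : |η x| ≤ 1) (h2 : ∀ k, |pd k η x| ≤ L) (h3 : ∀ k l, |pd k (pd l η) x| ≤ L)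
    (h4 : ∀ i k j l, |G i k j l x| ≤ t) (h5 : ∀ a i k j l, |pd a (G i k j l) x| ≤ t)
    (i j : Fin n) :
    |stress (fun i k j l => η * G i k j l) x i j| ≤ |stress G x i j| + n ^ 2 * (3 * (L * t)) := by
  have e : stress (fun i k j l => η * G i k j l) x i j = η x * stress G x i j +
      ∑ k, ∑ l, (pd k η x * pd l (G i k j l) x + pd l η x * pd k (G i k j l) x +
        pd k (pd l η) x * G i k j l x) := by
    simp only [stress_apply, Finset.mul_sum, ← Finset.sum_add_distrib]
    refine Finset.sum_congr rfl fun k _ => Finset.sum_congr rfl fun l _ => ?_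
    rw [pd_pd_mul k l hη (hG i k j l)]
    rfl
  rw [e]
  refine (abs_add_le _ _).trans (add_le_add ?_ ?_)
  · rw [abs_mul]
    exact mul_le_of_le_one_left (abs_nonneg _) h1
  · have hm : ∀ a b : ℝ, |a| ≤ L → |b| ≤ t → |a * b| ≤ L * t := fun a b ha hb => by
      rw [abs_mul]; exact mul_le_mul ha hb (abs_nonneg _) hL0
    have h : ∀ k l, |pd k η x * pd l (G i k j l) x + pd l η x * pd k (G i k j l) x +
        pd k (pd l η) x * G i k j l x| ≤ 3 * (L * t) := fun k l => by
      have a1 := hm _ _ (h2 k) (h5 l i k j l)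
      have a2 := hm _ _ (h2 l) (h5 k i k j l)
      have a3 := hm _ _ (h3 k l) (h4 i k j l)
      refine (abs_add_three _ _ _).trans ?_
      linarith
    refine (Finset.abs_sum_le_sum_abs _ _).trans ((Finset.sum_le_sum fun k _ =>
      (Finset.abs_sum_le_sum_abs _ _).trans (Finset.sum_le_sum fun l _ => h k l)).trans ?_)
    simp only [Finset.sum_const, Finset.card_univ, Fintype.card_fin, nsmul_eq_mul]
    exact le_of_eq (by ring)

/-- The rescaled potential on a cell of size `s⁻¹` with lower corner `p`: it replaces the
nonconstant part of the stress of `B` by the oscillating stress of `C`. -/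
noncomputable def cellPot (s : ℝ) (B C : Fin n → Fin n → Fin n → Fin n → (Fin n → ℝ) → ℝ)
    (p : Fin n → ℝ) (i k j l : Fin n) : (Fin n → ℝ) → ℝ :=
  (fun y => (s ^ 2)⁻¹ * C i k j l (s • y)) - taylorRem fun y => s ^ 2 * B i k j l (p + s⁻¹ • y)

lemma contDiff_comp_affine {f : (Fin n → ℝ) → ℝ} (hf : ContDiff ℝ (⊤ : ℕ∞) f) (c s : ℝ)
    (p : Fin n → ℝ) : ContDiff ℝ (⊤ : ℕ∞) fun y => c * f (p + s • y) :=
  contDiff_const.mul (hf.comp (contDiff_const.add (contDiff_id.const_smul s)))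

lemma contDiff_comp_smul {f : (Fin n → ℝ) → ℝ} (hf : ContDiff ℝ (⊤ : ℕ∞) f) (c s : ℝ) :
    ContDiff ℝ (⊤ : ℕ∞) fun y => c * f (s • y) :=
  contDiff_const.mul (hf.comp (contDiff_id.const_smul s))

lemma pd_mul_comp_affine {f : (Fin n → ℝ) → ℝ} (hf : ContDiff ℝ (⊤ : ℕ∞) f) (c s : ℝ)
    (p : Fin n → ℝ) (a : Fin n) :
    pd a (fun y => c * f (p + s • y)) = fun y => c * s * pd a f (p + s • y) := by
  have h := contDiff_comp_affine hf 1 s p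
  simp only [one_mul] at h
  change pd a (c • fun y => f (p + s • y)) = _
  rw [pd_smul a c h, pd_comp_affine a hf]
  ext y
  simp [mul_assoc]

lemma pd_pd_mul_comp_affine {f : (Fin n → ℝ) → ℝ} (hf : ContDiff ℝ (⊤ : ℕ∞) f) {s : ℝ}
    (hs : s ≠ 0) (p : Fin n → ℝ) (a b : Fin n) :
    pd b (pd a fun y => s ^ 2 * f (p + s⁻¹ • y)) = fun y => pd b (pd a f) (p + s⁻¹ • y) := by
  rw [pd_mul_comp_affine hf, pd_mul_comp_affine (hf.pd a)]
  ext y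
  field_simp

variable {s : ℝ}

lemma contDiff_cellPot (hB : IsPot B) (hC : IsPot C) (s : ℝ) (p : Fin n → ℝ) (i k j l : Fin n) :
    ContDiff ℝ (⊤ : ℕ∞) (cellPot s B C p i k j l) :=
  (contDiff_comp_smul (hC.smooth i k j l) _ s).sub
    (contDiff_taylorRem (contDiff_comp_affine (hB.smooth i k j l) _ _ p))

lemma cellPot_anti (hB : IsPot B) (hC : IsPot C) (s : ℝ) (p : Fin n → ℝ) (i k j l : Fin n) :
    cellPot s B C p i k l j = -cellPot s B C p i k j l := by
  have e : (fun y => s ^ 2 * B i k l j (p + s⁻¹ • y)) =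
      -fun y => s ^ 2 * B i k j l (p + s⁻¹ • y) := by
    ext y
    simp [hB.anti i k j l]
  rw [cellPot, e, taylorRem_neg, cellPot, hC.anti i k j l]
  ext y
  simp only [Pi.sub_apply, Pi.neg_apply]
  ring

lemma cellPot_symm (hB : IsPot B) (hC : IsPot C) (s : ℝ) (p : Fin n → ℝ) (i k j l : Fin n) :
    cellPot s B C p j l i k = cellPot s B C p i k j l := by
  rw [cellPot, cellPot, hB.symm, hC.symm]

lemma cellPot_add_int (hB : IsPot B) (s : ℝ) (p : Fin n → ℝ) (z : Fin n → ℤ) :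
    cellPot s B C (p + fun i => (z i : ℝ)) = cellPot s B C p := by
  ext i k j l y
  have e : (fun y => s ^ 2 * B i k j l (p + (fun i => (z i : ℝ)) + s⁻¹ • y)) =
      fun y => s ^ 2 * B i k j l (p + s⁻¹ • y) := by
    ext y
    rw [add_right_comm, (hB.smoothPer i k j l).per]
  rw [cellPot, e, cellPot]

lemma stress_cellPot (hB : IsPot B) (hC : IsPot C) (hs : 0 < s) (p y : Fin n → ℝ) :
    stress (cellPot s B C p) y = stress C (s • y) - (stress B (p + s⁻¹ • y) - stress B p) := by
  have e : cellPot s B C p = (fun i k j l y => (s ^ 2)⁻¹ * C i k j l (0 + s • y)) -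
      fun i k j l => taylorRem fun y => s ^ 2 * B i k j l (p + s⁻¹ • y) := by
    ext i k j l y
    simp [cellPot]
  rw [e, stress_sub (fun i k j l => contDiff_comp_affine (hC.smooth i k j l) _ _ _)
    (fun i k j l => contDiff_taylorRem (contDiff_comp_affine (hB.smooth i k j l) _ _ p)),
    stress_comp_affine hC.smooth 0 hs.ne', zero_add]
  congr 1
  ext i j
  simp only [Matrix.sub_apply, stress_apply, ← Finset.sum_sub_distrib]
  refine Finset.sum_congr rfl fun k _ => Finset.sum_congr rfl fun l _ => ?_
  rw [pd_pd_taylorRem (contDiff_comp_affine (hB.smooth i k j l) _ _ p),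
    pd_pd_mul_comp_affine (hB.smooth i k j l) hs.ne']
  simp

lemma abs_cellPot_le (hB : IsPot B) (hC : IsPot C) (hs : 1 ≤ s) {M Λ : ℝ}
    (h1 : ∀ i k j l x, |C i k j l x| ≤ M) (h2 : ∀ a i k j l x, |pd a (C i k j l) x| ≤ M)
    (hΛ0 : 0 ≤ Λ) (hΛ : ∀ a b i k j l x y,
      |pd b (pd a (B i k j l)) x - pd b (pd a (B i k j l)) y| ≤ Λ * ‖x - y‖)
    (p : Fin n → ℝ) {y : Fin n → ℝ} (hy : y ∈ Set.Icc (0 : Fin n → ℝ) 1) (i k j l : Fin n) :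
    |cellPot s B C p i k j l y| ≤ (M + n ^ 2 * Λ) / s ∧
    ∀ a, |pd a (cellPot s B C p i k j l) y| ≤ (M + n ^ 2 * Λ) / s := by
  have hs0 : 0 < s := by linarith
  have hg := contDiff_comp_affine (hB.smooth i k j l) (s ^ 2) s⁻¹ p
  have hω : ∀ a b, ∀ y ∈ Set.Icc (0 : Fin n → ℝ) 1,
      |pd b (pd a fun y => s ^ 2 * B i k j l (p + s⁻¹ • y)) y -
        pd b (pd a fun y => s ^ 2 * B i k j l (p + s⁻¹ • y)) 0| ≤ Λ / s := by
    intro a b y hy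
    rw [pd_pd_mul_comp_affine (hB.smooth i k j l) hs0.ne']
    refine (hΛ _ _ _ _ _ _ _ _).trans ?_
    rw [add_sub_add_left_eq_sub, smul_zero, sub_zero, norm_smul, norm_inv,
      Real.norm_of_nonneg hs0.le, div_eq_mul_inv]
    have : ‖y‖ ≤ 1 := (pi_norm_le_iff_of_nonneg zero_le_one).2 fun i => by
      rw [Real.norm_of_nonneg (hy.1 i)]; exact hy.2 i
    gcongr
    exact mul_le_of_le_one_right (by positivity) this
  have hsi : (s ^ 2)⁻¹ ≤ s⁻¹ := by
    gcongr
    nlinarith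
  constructor
  · have h3 : |(s ^ 2)⁻¹ * C i k j l (s • y)| ≤ s⁻¹ * M := by
      rw [abs_mul, abs_of_pos (by positivity)]
      gcongr
      exact h1 _ _ _ _ _
    refine (abs_sub _ _).trans ((add_le_add h3 (abs_taylorRem_le hg hω hy)).trans (le_of_eq ?_))
    field_simp
  · intro a
    rw [cellPot, pd_sub a (contDiff_comp_smul (hC.smooth i k j l) _ s) (contDiff_taylorRem hg)]
    have h3 : |pd a (fun y => (s ^ 2)⁻¹ * C i k j l (s • y)) y| ≤ s⁻¹ * M := by
      have := pd_mul_comp_affine (hC.smooth i k j l) (s ^ 2)⁻¹ s 0 a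
      simp only [zero_add] at this
      rw [this, abs_mul, show (s ^ 2)⁻¹ * s = s⁻¹ by field_simp, abs_of_pos (by positivity)]
      gcongr
      exact h2 _ _ _ _ _ _
    refine (abs_sub _ _).trans ((add_le_add h3 (abs_pd_taylorRem_le hg hω a hy)).trans ?_)
    have h4 : (n : ℝ) ≤ n ^ 2 := by exact_mod_cast Nat.le_self_pow two_ne_zero n
    rw [add_div, mul_div_assoc, ← div_eq_inv_mul]
    gcongr

/-- Correctors on the cells of a fine grid can be glued into a periodic potential. -/
lemma exists_isPot_cells (hB : IsPot B)
    {C : (Fin n → ℝ) → Fin n → Fin n → Fin n → Fin n → (Fin n → ℝ) → ℝ} (hC : ∀ p, IsPot (C p))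
    (hper : ∀ p (z : Fin n → ℤ), C (p + fun i => (z i : ℝ)) = C p)
    {η : (Fin n → ℝ) → ℝ} {r : ℝ} (hη : ContDiff ℝ (⊤ : ℕ∞) η) (hr : 0 < r)
    (h0 : ∀ x i, x i ∉ Set.Icc r (1 - r) → η x = 0) {m : ℕ} (hm : 0 < m) :
    ∃ D : Fin n → Fin n → Fin n → Fin n → (Fin n → ℝ) → ℝ, IsPot D ∧
      ∀ (c : Fin n → ℤ), ∀ y ∈ unitCube n,
        stress D ((m : ℝ)⁻¹ • ((fun i => (c i : ℝ)) + y)) =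
          stress B ((m : ℝ)⁻¹ • ((fun i => (c i : ℝ)) + y)) +
          stress (fun i k j l => η * cellPot (m : ℝ) B (C ((m : ℝ)⁻¹ • fun i => (c i : ℝ)))
            ((m : ℝ)⁻¹ • fun i => (c i : ℝ)) i k j l) y := by
  have hm' : (0 : ℝ) < m := by exact_mod_cast hm
  let P : (Fin n → ℤ) → Fin n → ℝ := fun c => (m : ℝ)⁻¹ • fun i => (c i : ℝ)
  let V : Fin n → Fin n → Fin n → Fin n → (Fin n → ℤ) → (Fin n → ℝ) → ℝ :=
    fun i k j l c => η * cellPot (m : ℝ) B (C (P c)) (P c) i k j l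
  have hVs : ∀ i k j l c, ContDiff ℝ (⊤ : ℕ∞) (V i k j l c) := fun i k j l c =>
    hη.mul (contDiff_cellPot hB (hC _) _ _ i k j l)
  have hV0 : ∀ i k j l c y a, y a ∉ Set.Icc r (1 - r) → V i k j l c y = 0 :=
      fun i k j l c y a h => by
    simp only [V, Pi.mul_apply, h0 y a h, zero_mul]
  have hVper : ∀ i k j l c (z : Fin n → ℤ), V i k j l (fun a => c a + m * z a) = V i k j l c := by
    intro i k j l c z
    have e : P (fun a => c a + m * z a) = P c + fun a => (z a : ℝ) := by
      ext a
      simp [P]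
      field_simp
    simp only [V, e, hper, cellPot_add_int hB]
  have hgs : ∀ i k j l, ContDiff ℝ (⊤ : ℕ∞) (glue (V i k j l)) := fun i k j l =>
    contDiff_glue (hVs i k j l) hr (hV0 i k j l)
  let W : Fin n → Fin n → Fin n → Fin n → (Fin n → ℝ) → ℝ :=
    fun i k j l x => ((m : ℝ) ^ 2)⁻¹ * glue (V i k j l) (0 + (m : ℝ) • x)
  have hWs : ∀ i k j l, ContDiff ℝ (⊤ : ℕ∞) (W i k j l) := fun i k j l =>
    contDiff_comp_affine (hgs i k j l) _ _ _
  have hW : IsPot W := by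
    refine ⟨fun i k j l => ⟨hWs i k j l, fun x z => ?_⟩, fun i k j l => ?_, fun i k j l => ?_⟩
    · dsimp only [W]
      have h1 : ∀ a, ⌊(m : ℝ) * (x a + z a)⌋ = ⌊(m : ℝ) * x a⌋ + m * z a := fun a => by
        rw [mul_add, show (m : ℝ) * z a = ((m * z a : ℤ) : ℝ) by push_cast; rfl,
          Int.floor_add_intCast]
      have h2 : ∀ a, Int.fract ((m : ℝ) * (x a + z a)) = Int.fract ((m : ℝ) * x a) := fun a => by
        rw [mul_add, show (m : ℝ) * z a = ((m * z a : ℤ) : ℝ) by push_cast; rfl,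
          Int.fract_add_intCast]
      simp only [glue, Pi.zero_apply, zero_add, Pi.add_apply, Pi.smul_apply, smul_eq_mul, h1, h2,
        hVper]
    · have e : V i k l j = -V i k j l := by
        ext c y
        simp only [V, Pi.neg_apply, Pi.mul_apply, cellPot_anti hB (hC _) _ _ i k j l]
        ring
      ext x
      simp only [W, e, glue, Pi.neg_apply]
      ring
    · have e : V j l i k = V i k j l := by
        ext c y
        simp only [V, cellPot_symm hB (hC _) _ _ i k j l]
      ext x
      simp only [W, e]
  refine ⟨B + W, hB.add hW, fun c y hy => ?_⟩
  rw [stress_add hB.smooth hWs]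
  congr 1
  rw [stress_comp_affine hgs 0 hm'.ne', zero_add, smul_inv_smul₀ hm'.ne']
  have hy' : (fun i => (c i : ℝ)) + y - (fun i => (c i : ℝ)) ∈ unitCube n := by
    rwa [add_sub_cancel_left]
  rw [stress_congr fun i k j l => glue_eventuallyEq (V i k j l) c hy']
  have h := stress_comp_affine (fun i k j l => hVs i k j l c) (-fun i => (c i : ℝ)) one_ne_zero
    ((fun i => (c i : ℝ)) + y)
  simp only [one_pow, inv_one, one_mul, one_smul, neg_add_cancel_left] at h
  rw [← h]
  simp only [neg_add_eq_sub]

end cells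

section main

variable {n : ℕ} {α β : ℝ}

lemma setIntegral_unitCube_le_add {f g : (Fin n → ℝ) → ℝ} {S : Set (Fin n → ℝ)}
    (hf : IntegrableOn f (unitCube n)) (hg : IntegrableOn g (unitCube n)) (hS : MeasurableSet S)
    (hSQ : S ⊆ unitCube n) {H : ℝ} (hg0 : ∀ y, 0 ≤ g y) (h1 : ∀ y ∈ S, f y = g y)
    (h2 : ∀ y ∈ unitCube n, f y ≤ H) :
    ∫ y in unitCube n, f y ≤ (∫ y in unitCube n, g y) + H * volume.real (unitCube n \ S) := by
  have hd : MeasurableSet (unitCube n \ S) := measurableSet_unitCube.diff hS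
  have e := integral_inter_add_sdiff hS hf
  rw [Set.inter_eq_right.2 hSQ] at e
  rw [← e, setIntegral_congr_fun hS h1]
  refine add_le_add (setIntegral_mono_set hg (Filter.Eventually.of_forall hg0)
    hSQ.eventuallyLE) ?_
  have hfin : volume (unitCube n \ S) ≠ ⊤ :=
    ((measure_mono Set.sdiff_subset).trans_lt (by simp [volume_unitCube])).ne
  refine (setIntegral_mono_on (hf.mono_set Set.sdiff_subset)
    (integrableOn_const hfin) hd fun y hy => h2 y hy.1).trans (le_of_eq ?_)
  rw [setIntegral_const, smul_eq_mul, mul_comm]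

lemma exists_grid {T L ρ : ℝ} (hρ : 0 < ρ) :
    ∃ m : ℕ, 0 < m ∧ n ^ 2 * (3 * (L * (T / m))) ≤ 1 ∧ (m : ℝ)⁻¹ < ρ := by
  obtain ⟨m, hm⟩ := exists_nat_gt (max 1 (max (n ^ 2 * (3 * (L * T))) ρ⁻¹))
  have h1 := (le_max_left _ _).trans_lt hm
  have h2 := ((le_max_left _ _).trans (le_max_right _ _)).trans_lt hm
  have h3 := ((le_max_right _ _).trans (le_max_right _ _)).trans_lt hm
  have hm0 : (0 : ℝ) < m := by linarith
  refine ⟨m, by exact_mod_cast hm0, ?_, inv_lt_of_inv_lt₀ hρ h3⟩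
  rw [show (n : ℝ) ^ 2 * (3 * (L * (T / m))) = n ^ 2 * (3 * (L * T)) / m by ring,
    div_le_one hm0]
  exact h2.le

lemma QdivKohnStrang_mean_le (hn : 2 ≤ n) (hα : 0 < α) (hβ : 0 < β)
    {ψ : (Fin n → ℝ) → Matrix (Fin n) (Fin n) ℝ} (hψ : Admissible ψ) {ε : ℝ} (hε : 0 < ε) :
    QdivKohnStrang n α β (Matrix.of fun i j => ∫ x in unitCube n, ψ x i j) ≤
      (∫ x in unitCube n, QdivKohnStrang n α β (ψ x)) + 3 * ε := by
  set A : Matrix (Fin n) (Fin n) ℝ := Matrix.of fun i j => ∫ x in unitCube n, ψ x i j with hAdef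
  have hA : A.IsSymm := by
    ext i j
    simp only [hAdef, Matrix.transpose_apply, Matrix.of_apply, (hψ.2.2.1 _).apply i j]
  obtain ⟨B, hB, hψB⟩ := hψ.exists_eq_mean_add_stress
  rw [← hAdef] at hψB
  obtain ⟨K, hK0, hK⟩ := hψ.exists_bound
  obtain ⟨ρ, hρ, hunif⟩ := hψ.uniformity hn hα hβ hε
  obtain ⟨M₀, hM₀⟩ := hψ.exists_hasCorrector hn hα hβ hε
  obtain ⟨M, hM0, hM⟩ : ∃ M, 0 ≤ M ∧
      ∀ x, HasCorrector α β M (ψ x) (QdivKohnStrang n α β (ψ x) + ε) :=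
    ⟨max 0 M₀, le_max_left _ _, fun x => (hM₀ x).mono (le_max_right _ _) le_rfl⟩
  have hcor : ∀ X ∈ Set.range ψ, HasCorrector α β M X (QdivKohnStrang n α β X + ε) := by
    rintro _ ⟨x, rfl⟩
    exact hM x
  choose! C hC hC1 hC2 hC3 hC4 using hcor
  obtain ⟨Λ, hΛ0, hΛ⟩ := exists_common_lipschitz
    (F := fun (p : Fin n × Fin n × Fin n × Fin n × Fin n × Fin n) =>
      pd p.2.1 (pd p.1 (B p.2.2.1 p.2.2.2.1 p.2.2.2.2.1 p.2.2.2.2.2)))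
    fun p => ((hB.smoothPer _ _ _ _).pd _).pd _
  set H : ℝ := α * (n ^ 2 * (3 * K + M + 1) ^ 2) + β with hH
  have hH0 : 0 < H := by positivity
  obtain ⟨η, r, S, L, hη, hη1, hr, hηr, hSo, hSQ, hηS, hSκ, hL0, hL1, hL2⟩ :=
    exists_cutoff n (div_pos hε hH0)
  obtain ⟨m, hm, hmT, hmρ⟩ := exists_grid (n := n) (T := M + n ^ 2 * Λ) (L := L) hρ
  have hm' : (0 : ℝ) < m := by exact_mod_cast hm
  have hm1 : (1 : ℝ) ≤ m := by exact_mod_cast hm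
  obtain ⟨D, hD, hDc⟩ := exists_isPot_cells hB (C := fun p => C (ψ p)) (fun p => hC _ ⟨p, rfl⟩)
    (fun p z => by rw [hψ.2.1 p z]) hη hr hηr hm
  set q : (Fin n → ℝ) → ℝ := fun x => QdivKohnStrang n α β (ψ x) with hq
  have hqc : Continuous q := hψ.continuous_QdivKohnStrang hn hα hβ
  obtain ⟨Kq, hKq0, hKq⟩ := hψ.exists_QdivKohnStrang_bound hα hβ
  obtain ⟨KD, hKD⟩ := hD.exists_abs_kohnStrang_le hα hβ A
  have hDm := hD.measurable_kohnStrang (α := α) (β := β) A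
  have key : ∀ c : Fin n → ℤ,
      ∫ y in unitCube n, kohnStrang α β (A + stress D ((m : ℝ)⁻¹ • ((fun i => (c i : ℝ)) + y))) ≤
        ∫ y in unitCube n, (q ((m : ℝ)⁻¹ • ((fun i => (c i : ℝ)) + y)) + 3 * ε) := by
    intro c
    set p : Fin n → ℝ := (m : ℝ)⁻¹ • fun i => (c i : ℝ) with hp
    have hpx : ∀ y, (m : ℝ)⁻¹ • ((fun i => (c i : ℝ)) + y) = p + (m : ℝ)⁻¹ • y := fun y => by
      rw [smul_add]
    have hCp := hC _ ⟨p, rfl⟩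
    have hG : ∀ i k j l, ContDiff ℝ (⊤ : ℕ∞) (cellPot (m : ℝ) B (C (ψ p)) p i k j l) :=
      contDiff_cellPot hB hCp m p
    have hΦ : ∀ y ∈ unitCube n, A + stress D (p + (m : ℝ)⁻¹ • y) = ψ (p + (m : ℝ)⁻¹ • y) +
        stress (fun i k j l => η * cellPot (m : ℝ) B (C (ψ p)) p i k j l) y := fun y hy => by
      rw [← hpx, hDc c y hy, ← add_assoc, ← hψB]
    have hsG : ∀ y, stress (cellPot (m : ℝ) B (C (ψ p)) p) y =
        stress (C (ψ p)) ((m : ℝ) • y) - (ψ (p + (m : ℝ)⁻¹ • y) - ψ p) := fun y => by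
      rw [stress_cellPot hB hCp hm',
        ← add_sub_add_left_eq_sub (stress B _) _ A, ← hψB, ← hψB]
    have hgood : ∀ y ∈ S, kohnStrang α β (A + stress D (p + (m : ℝ)⁻¹ • y)) =
        kohnStrang α β (ψ p + stress (C (ψ p)) ((m : ℝ) • y)) := fun y hy => by
      have e : stress (fun i k j l => η * cellPot (m : ℝ) B (C (ψ p)) p i k j l) y =
          stress (cellPot (m : ℝ) B (C (ψ p)) p) y := by
        refine stress_congr fun i k j l => ?_
        filter_upwards [hSo.mem_nhds hy] with z hz
        rw [Pi.mul_apply, hηS z hz, one_mul]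
      rw [hΦ y (hSQ hy), e, hsG]
      congr 1
      abel
    have hbad : ∀ y ∈ unitCube n, kohnStrang α β (A + stress D (p + (m : ℝ)⁻¹ • y)) ≤ H := by
      intro y hy
      refine kohnStrang_le_of_abs_le hα hβ fun i j => ?_
      have hT := abs_cellPot_le hB hCp hm1 (hC1 _ ⟨p, rfl⟩) (hC2 _ ⟨p, rfl⟩) hΛ0
        (fun a b i k j l x y => hΛ (a, b, i, k, j, l) x y) p (unitCube_subset_Icc hy)
      have h1 := abs_stress_mul_le hη hG hL0 (hη1 y) (fun k => hL1 k y) (fun k l => hL2 k l y)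
        (fun i k j l => (hT i k j l).1) (fun a i k j l => (hT i k j l).2 a) i j
      have h2 : |stress (cellPot (m : ℝ) B (C (ψ p)) p) y i j| ≤ M + (K + K) := by
        rw [hsG, Matrix.sub_apply, Matrix.sub_apply]
        exact (abs_sub _ _).trans (add_le_add (hC3 _ ⟨p, rfl⟩ _ _ _)
          ((abs_sub _ _).trans (add_le_add (hK _ _ _) (hK _ _ _))))
      rw [hΦ y hy, Matrix.add_apply]
      refine (abs_add_le _ _).trans ?_
      linarith [hK (p + (m : ℝ)⁻¹ • y) i j]
    simp only [hpx]
    have haff : Measurable fun y : Fin n → ℝ => p + (m : ℝ)⁻¹ • y := by fun_prop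
    have hcm := hCp.measurable_kohnStrang (α := α) (β := β) (ψ p)
    obtain ⟨KC, hKC⟩ := hCp.exists_abs_kohnStrang_le hα hβ (ψ p)
    have hle := setIntegral_unitCube_le_add
      (integrableOn_unitCube (hDm.comp haff) fun x => hKD _)
      (integrableOn_unitCube (hcm.comp (measurable_const_smul (m : ℝ))) fun x => hKC _)
      hSo.measurableSet hSQ (fun y => kohnStrang_nonneg hα hβ _) hgood hbad
    have hcell := setIntegral_unitCube_comp_smul hcm hKC
      (fun x z => by
        congr 2
        ext i j
        exact (hCp.smoothPer_stress i j).per x z) hm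
    simp only [Function.comp_def] at hle
    rw [hcell] at hle
    have hκ : H * volume.real (unitCube n \ S) ≤ ε := by
      rw [le_div_iff₀ hH0] at hSκ
      linarith
    have hqp : ∫ y in unitCube n, (q p + 2 * ε) ≤
        ∫ y in unitCube n, (q (p + (m : ℝ)⁻¹ • y) + 3 * ε) := by
      refine setIntegral_mono_on continuous_const.integrableOn_unitCube
        (Continuous.integrableOn_unitCube (by fun_prop)) measurableSet_unitCube fun y hy => ?_
      have hy1 : ‖y‖ ≤ 1 := (pi_norm_le_iff_of_nonneg zero_le_one).2 fun i => by
        rw [Real.norm_of_nonneg (hy i trivial).1.le]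
        exact (hy i trivial).2.le
      have hd : ‖p - (p + (m : ℝ)⁻¹ • y)‖ < ρ := by
        rw [sub_add_cancel_left, norm_neg, norm_smul, norm_inv, Real.norm_of_nonneg hm'.le]
        exact (mul_le_of_le_one_right (by positivity) hy1).trans_lt hmρ
      linarith [hunif p _ hd]
    rw [setIntegral_unitCube_const] at hqp
    linarith [hC4 _ ⟨p, rfl⟩]
  have hqm : Measurable fun x => q x + 3 * ε := by
    have := hqc.measurable
    fun_prop
  have hqb : ∀ x, |q x + 3 * ε| ≤ Kq + 3 * ε := fun x => by
    have := QdivKohnStrang_nonneg hα hβ (ψ x)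
    rw [abs_of_nonneg (by positivity)]
    linarith [hKq x]
  calc QdivKohnStrang n α β A
      ≤ ∫ x in unitCube n, kohnStrang α β (A + stress D x) := QdivKohnStrang_le hα hβ hA hD
    _ ≤ ∫ x in unitCube n, (q x + 3 * ε) := by
        rw [setIntegral_unitCube_eq_sum hDm hKD hm, setIntegral_unitCube_eq_sum hqm hqb hm]
        refine Finset.sum_le_sum fun c _ => mul_le_mul_of_nonneg_left ?_ (by positivity)
        simpa using key fun i => (c i : ℕ)
    _ = (∫ x in unitCube n, q x) + 3 * ε := by
        rw [integral_add hqc.integrableOn_unitCube continuous_const.integrableOn_unitCube,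
          setIntegral_unitCube_const]

end main

/-- The div-quasiconvex envelope `Q_div h` of the Kohn–Strang function is
itself (symmetric) div-quasiconvex. -/
theorem QdivKohnStrang_divQuasiconvex (n : ℕ) (hn : 2 ≤ n)
    (α β : ℝ) (hα : 0 < α) (hβ : 0 < β)
    (ψ : (Fin n → ℝ) → Matrix (Fin n) (Fin n) ℝ) (hψ : Admissible ψ) :
    QdivKohnStrang n α β (Matrix.of fun i j => ∫ x in unitCube n, ψ x i j) ≤
      ∫ x in unitCube n, QdivKohnStrang n α β (ψ x) := by
  refine le_of_forall_pos_le_add fun ε hε => ?_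
  have := QdivKohnStrang_mean_le hn hα hβ hψ (div_pos hε three_pos)
  linarith
end
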